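/- For every prime p and integer e ≥ 1, the L-theory SHF-bar_{p,e} is complete: it is satisfiable and for every L-sentence σ, either every model of SHF-bar_{p,e} satisfies σ or every model satisfies ¬σ. -/

import Mathlib

noncomputable section

open FirstOrder FirstOrder.Language

/-- The `m`-th Witt addition polynomial with coefficients reduced mod `p`. -/
def wittHmod (p : ℕ) [Fact p.Prime] (m : ℕ) : MvPolynomial (Fin 2 × ℕ) (ZMod p) :=
  MvPolynomial.map (Int.castRingHom (ZMod p)) (WittVector.wittAdd p m)

/-- The exponent of the monomial `X̄^i * Ȳ^j`. -/
def xyExp (e : ℕ) (i j : Fin e → ℕ) : (Fin 2 × ℕ) →₀ ℕ :=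
  ∑ m : Fin e, (Finsupp.single ((0 : Fin 2), (m : ℕ)) (i m) +
    Finsupp.single ((1 : Fin 2), (m : ℕ)) (j m))

/-- `wittAlpha p e i j l` is the coefficient `α_{i,j}(l) ∈ 𝔽_p` of `X̄^i * Ȳ^j` in
`H_1^{l_1} ⋯ H_e^{l_e}`. -/
def wittAlpha (p : ℕ) [Fact p.Prime] (e : ℕ) (i j l : Fin e → ℕ) : ZMod p :=
  MvPolynomial.coeff (xyExp e i j) (∏ m : Fin e, (wittHmod p (m : ℕ)) ^ (l m))

/-- `hsComp p e D v = D_{v_1} ∘ (D_{v_2})^(p) ∘ … ∘ (D_{v_e})^(p^{e-1})`. -/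
def hsComp {K : Type*} (p e : ℕ) (D : ℕ → K → K) (v : Fin e → ℕ) : K → K :=
  (List.ofFn fun m : Fin e => (D (v m))^[p ^ (m : ℕ)]).foldr (· ∘ ·) id

/-- The language consisting of one unary function symbol `D_n` for each `n ∈ ℕ`. -/
def dLang : FirstOrder.Language :=
  { Functions := fun n => match n with | 1 => ℕ | _ => Empty
    Relations := fun _ => Empty }

/-- The language `L` of the theory `SHF-bar_{p,e}`: the language of rings `(+, *, -, 0, 1)`
augmented by a unary function symbol `D_n` for each `n ∈ ℕ`. -/
def shfLang : FirstOrder.Language := Language.ring.sum dLang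

/-- The unary function symbol `D_n` of `shfLang`. -/
def dSymb (n : ℕ) : shfLang.Functions 1 := Sum.inr n

/-- The interpretation of a function symbol of `shfLang` in a `shfLang`-structure. -/
def shfFun {M : Type*} [shfLang.Structure M] {n : ℕ} (f : shfLang.Functions n)
    (v : Fin n → M) : M :=
  Structure.funMap f v

/-- The interpretation of the symbol `D_n` in a `shfLang`-structure. -/
def shfD {M : Type*} [shfLang.Structure M] (n : ℕ) (x : M) : M :=
  shfFun (dSymb n) ![x]

/-- A `shfLang`-structure `M` is a model of `SHF-bar_{p,e}` iff:  the ring symbols are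
interpreted as the operations of a field structure on `M` of characteristic `p` (H0');
`M` is separably closed (H7', the scheme that every monic polynomial coprime to its formal
derivative has a root); and the operators `D_n := shfD n` satisfy `D_0 = id` and the axiom
schemes H1', H2', H3', H4', H5', H6' and H8'. -/
def IsSHFStructure (p e : ℕ) [Fact p.Prime] (M : Type*) [shfLang.Structure M] : Prop :=
  ∃ (_ : Field M) (_ : CharP M p),
    (∀ a b : M, shfFun (Sum.inl ringFunc.add) ![a, b] = a + b) ∧
    (∀ a b : M, shfFun (Sum.inl ringFunc.mul) ![a, b] = a * b) ∧
    (∀ a : M, shfFun (Sum.inl ringFunc.neg) ![a] = -a) ∧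
    (shfFun (Sum.inl ringFunc.zero) ![] = (0 : M)) ∧
    (shfFun (Sum.inl ringFunc.one) ![] = (1 : M)) ∧
    IsSepClosed M ∧
    (∀ x : M, shfD 0 x = x) ∧
    (∀ n : ℕ, ∀ x y : M, shfD n (x + y) = shfD n x + shfD n y) ∧
    (∀ n : ℕ, ∀ x y : M,
      shfD n (x * y) = ∑ k ∈ Finset.range (n + 1), shfD k x * shfD (n - k) y) ∧
    (∀ i j : ℕ, ∀ x : M, shfD i (shfD j x) = shfD j (shfD i x)) ∧
    (∀ n : ℕ, 1 ≤ n → ∀ x : M, (shfD n)^[p ^ e] x = 0) ∧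
    (∃ x : M, (shfD 1)^[p ^ e - 1] x ≠ 0) ∧
    (∀ x : M, shfD 1 x = 0 → ∃ y : M, x = y ^ p) ∧
    (∀ i j : Fin e → ℕ, ∀ x : M,
      hsComp p e shfD i (hsComp p e shfD j x) =
        ∑ᶠ l : Fin e → ℕ, ZMod.cast (wittAlpha p e i j l) * hsComp p e shfD l x)

/-- The theory `SHF-bar_{p,e}`, presented as the set of all of its logical consequences:
the set of `shfLang`-sentences true in every structure satisfying the axioms
H0'–H8' (as encoded by `IsSHFStructure`).  A theory presented this way has the same models,
and hence the same satisfiability, completeness and quantifier-elimination properties,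
as the axiom system H0'–H8' itself. -/
def shfTheory (p e : ℕ) [Fact p.Prime] : shfLang.Theory :=
  {σ : shfLang.Sentence |
    ∀ (M : Type) (_ : shfLang.Structure M), IsSHFStructure p e M → M ⊨ σ}

open Finset.HasAntidiagonal (antidiagonal)

/-- A Hasse–Schmidt derivation of a commutative ring, as a sequence of functions. -/
structure IsHS {R : Type*} [CommRing R] (D : ℕ → R → R) : Prop where
  zero : ∀ x, D 0 x = x
  add : ∀ n x y, D n (x + y) = D n x + D n y
  mul : ∀ n x y, D n (x * y) = ∑ a ∈ antidiagonal n, D a.1 x * D a.2 y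

/-- The freshman's dream for pairwise commuting elements of a ring of characteristic `p`. -/
theorem sum_pow_prime_of_commute {S ι : Type*} [Semiring S] {p : ℕ} (hp : p.Prime)
    (h0 : (p : S) = 0) (s : Finset ι) (f : ι → S) (hc : ∀ a b, Commute (f a) (f b)) :
    (∑ a ∈ s, f a) ^ p = ∑ a ∈ s, f a ^ p := by
  classical
  induction s using Finset.induction_on with
  | empty => simp [hp.ne_zero]
  | insert a s has ih =>
    rw [Finset.sum_insert has, Finset.sum_insert has,
      (Commute.sum_right s f (f a) (fun b _ => hc a b)).add_pow_prime_eq hp, ih, h0]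
    simp

/-- The `p`-th power of a sum of commuting additive operators. -/
theorem iterate_sum_of_commute {V ι : Type*} [AddCommGroup V] {p : ℕ} (hp : p.Prime)
    (h0 : ∀ v : V, p • v = 0) (s : Finset ι) (f : ι → Module.End ℤ V)
    (hc : ∀ a b, Commute (f a) (f b)) (v : V) :
    (⇑(∑ a ∈ s, f a))^[p] v = ∑ a ∈ s, (f a)^[p] v := by
  have h := sum_pow_prime_of_commute hp (S := Module.End ℤ V)
    (by ext v; simpa using h0 v) s f hc
  have := DFunLike.congr_fun h v
  simpa only [Module.End.pow_apply, LinearMap.sum_apply] using this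

namespace IsHS

variable {R : Type*} [CommRing R] {D : ℕ → R → R}

theorem mul_range (h : IsHS D) (n : ℕ) (x y : R) :
    D n (x * y) = ∑ k ∈ Finset.range (n + 1), D k x * D (n - k) y := by
  rw [h.mul, Finset.Nat.sum_antidiagonal_eq_sum_range_succ (fun a b => D a x * D b y)]

theorem map_zero (h : IsHS D) (n : ℕ) : D n 0 = 0 := by
  simpa using h.add n 0 0

theorem one_eq_zero (h : IsHS D) : ∀ n, 1 ≤ n → D n 1 = 0 := by
  intro n
  induction n using Nat.strong_induction_on with
  | _ n ih =>
    intro hn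
    have h1 := h.mul_range n 1 1
    obtain ⟨m, rfl⟩ : ∃ m, n = m + 1 := ⟨n - 1, by omega⟩
    rw [Finset.sum_range_succ, Finset.sum_range_succ'] at h1
    rw [Finset.sum_eq_zero] at h1
    · simpa [h.zero] using h1
    · intro k hk
      rw [Finset.mem_range] at hk
      rw [ih (k + 1) (by omega) (by omega), zero_mul]

/-- The additive endomorphism underlying a component of a Hasse–Schmidt derivation. -/
def addHom (h : IsHS D) (n : ℕ) : Module.End ℤ R :=
  (AddMonoidHom.mk' (D n) (h.add n)).toIntLinearMap

theorem addHom_apply (h : IsHS D) (n : ℕ) (x : R) : h.addHom n x = D n x := rfl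

/-- The Taylor homomorphism attached to a Hasse–Schmidt derivation. -/
def toRingHom (h : IsHS D) : R →+* PowerSeries R where
  toFun x := PowerSeries.mk fun n => D n x
  map_one' := by
    ext n
    rw [PowerSeries.coeff_mk, PowerSeries.coeff_one]
    split_ifs with hn
    · rw [hn, h.zero]
    · exact h.one_eq_zero n (by omega)
  map_zero' := by ext n; simp [h.map_zero]
  map_add' x y := by ext n; simp [h.add]
  map_mul' x y := by ext n; simp [h.mul, PowerSeries.coeff_mul]

@[simp] theorem coeff_toRingHom (h : IsHS D) (n : ℕ) (x : R) :
    PowerSeries.coeff n (h.toRingHom x) = D n x :=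
  PowerSeries.coeff_mk n fun n => D n x

theorem of_ringHom (φ : R →+* PowerSeries R) (h0 : ∀ x, PowerSeries.coeff 0 (φ x) = x) :
    IsHS fun n x => PowerSeries.coeff n (φ x) where
  zero := h0
  add n x y := by simp
  mul n x y := by rw [map_mul, PowerSeries.coeff_mul]

/-- The `p`-fold iterates of a commuting Hasse–Schmidt derivation in characteristic `p` form a
Hasse–Schmidt derivation. -/
theorem iterate_prime (h : IsHS D) {p : ℕ} (hp : p.Prime) [CharP R p]
    (hcomm : ∀ i j x, D i (D j x) = D j (D i x)) : IsHS fun n => (D n)^[p] where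
  zero x := Function.iterate_fixed (h.zero x) p
  add n x y := by
    have := (h.addHom n ^ p).map_add x y
    simp only [Module.End.pow_apply] at this
    exact this
  mul n x y := by
    let T : ℕ × ℕ → Module.End ℤ (R → R → R) := fun a =>
      { toFun := fun B x y => B (D a.1 x) (D a.2 y)
        map_add' := fun _ _ => rfl
        map_smul' := fun _ _ => rfl }
    have hT : ∀ a b, Commute (T a) (T b) := fun a b => by
      ext B x y
      change B (D b.1 (D a.1 x)) (D b.2 (D a.2 y)) = B (D a.1 (D b.1 x)) (D a.2 (D b.2 y))
      rw [hcomm, hcomm a.2]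
    have hTit : ∀ a k B x y, ((T a)^[k] B) x y = B ((D a.1)^[k] x) ((D a.2)^[k] y) := by
      intro a k B
      induction k with
      | zero => intro x y; rfl
      | succ k ih =>
        intro x y
        rw [Function.iterate_succ_apply', Function.iterate_succ_apply, Function.iterate_succ_apply]
        exact ih _ _
    let μ : R → R → R := fun x y => x * y
    let S : Module.End ℤ (R → R → R) := ∑ a ∈ antidiagonal n, T a
    have hS : ∀ B x y, S B x y = ∑ a ∈ antidiagonal n, B (D a.1 x) (D a.2 y) := by
      intro B x y
      simp only [S, LinearMap.sum_apply, Finset.sum_apply]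
      rfl
    have hO : ∀ k x y, (D n)^[k] (μ x y) = (S^[k] μ) x y := by
      intro k
      induction k with
      | zero => intro x y; rfl
      | succ k ih =>
        intro x y
        rw [Function.iterate_succ_apply, Function.iterate_succ_apply', hS]
        change (D n)^[k] (D n (x * y)) = _
        rw [h.mul, show D n = ⇑(h.addHom n) from rfl, ← Module.End.pow_apply,
          map_sum]
        refine Finset.sum_congr rfl fun a _ => ?_
        rw [Module.End.pow_apply]
        exact ih _ _
    refine (hO p x y).trans ?_
    rw [iterate_sum_of_commute hp (fun v => by ext; simp) _ _ hT, Finset.sum_apply,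
      Finset.sum_apply]
    exact Finset.sum_congr rfl fun a _ => hTit _ _ _ _ _

theorem comm_iterate {M : Type*} {D : ℕ → M → M} (hcomm : ∀ i j x, D i (D j x) = D j (D i x))
    (i j a b : ℕ) (x : M) :
    (D i)^[a] ((D j)^[b] x) = (D j)^[b] ((D i)^[a] x) :=
  Function.Commute.iterate_iterate (f := D i) (g := D j) (fun x => hcomm i j x) a b x

theorem iterate_prime_pow (h : IsHS D) {p : ℕ} (hp : p.Prime) [CharP R p]
    (hcomm : ∀ i j x, D i (D j x) = D j (D i x)) (m : ℕ) : IsHS fun n => (D n)^[p ^ m] := by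
  induction m with
  | zero => simpa using h
  | succ m ih =>
    have := ih.iterate_prime hp (fun i j x => comm_iterate hcomm i j _ _ x)
    simpa only [pow_succ, Function.iterate_mul] using this

/-- In characteristic `p`, the low order components of a Hasse–Schmidt derivation are linear over
`p ^ m`-th powers. -/
theorem mul_pow (h : IsHS D) {p : ℕ} (hp : p.Prime) [CharP R p] (m n : ℕ) (hn : n < p ^ m)
    (x y : R) : D n (x * y ^ p ^ m) = D n x * y ^ p ^ m := by
  have key : ∀ k, 1 ≤ k → k < p ^ m → D k (y ^ p ^ m) = 0 := by
    intro k hk1 hk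
    have : ExpChar R p := ExpChar.prime hp
    have h2 : PowerSeries.coeff k (h.toRingHom (y ^ p ^ m)) = 0 := by
      rw [map_pow]
      have := MvPowerSeries.map_iterateFrobenius_expand p hp.ne_zero (h.toRingHom y) m
      have h3 : PowerSeries.coeff k (h.toRingHom y ^ p ^ m)
        = MvPowerSeries.coeff (Finsupp.single () k) (h.toRingHom y ^ p ^ m) := rfl
      rw [h3, ← this, MvPowerSeries.coeff_map, MvPowerSeries.coeff_expand_of_not_dvd, _root_.map_zero]
      · exact ()
      · rw [Finsupp.single_eq_same]
        exact fun hd => absurd (Nat.le_of_dvd (by omega) hd) (by omega)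
    rwa [coeff_toRingHom] at h2
  rw [h.mul, Finset.sum_eq_single (n, 0)]
  · rw [h.zero]
  · intro a ha hne
    rw [Finset.HasAntidiagonal.mem_antidiagonal] at ha
    rw [key a.2, mul_zero]
    · by_contra h0
      exact hne (Prod.ext (by simp only; omega) (by simp only; omega))
    · omega
  · intro h'; simp at h'

theorem hsComp_zero_of {M : Type*} {p e : ℕ} {D : ℕ → M → M} (h0 : ∀ x, D 0 x = x) (x : M) :
    hsComp p e D 0 x = x := by
  have : ∀ l : List (M → M), (∀ f ∈ l, ∀ y, f y = y) → l.foldr (· ∘ ·) id x = x := by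
    intro l
    induction l with
    | nil => intro _; rfl
    | cons f l ih =>
      intro hl
      rw [List.foldr_cons, Function.comp_apply, ih fun g hg => hl g (List.mem_cons_of_mem _ hg)]
      exact hl f List.mem_cons_self x
  refine this _ fun f hf y => ?_
  rw [List.mem_ofFn] at hf
  obtain ⟨m, rfl⟩ := hf
  exact Function.iterate_fixed (h0 y) _

/-- A composition of finitely many families of operators. -/
def familyComp {M : Type*} {e : ℕ} (E : Fin e → ℕ → M → M) (v : Fin e → ℕ) : M → M :=
  (List.ofFn fun m : Fin e => E m (v m)).foldr (· ∘ ·) id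

theorem familyComp_succ {M : Type*} {e : ℕ} (E : Fin (e + 1) → ℕ → M → M) (v : Fin (e + 1) → ℕ)
    (x : M) :
    familyComp E v x = E 0 (v 0) (familyComp (fun m => E m.succ) (fun m => v m.succ) x) := by
  rw [familyComp, List.ofFn_succ]
  rfl

theorem hsComp_eq_familyComp {M : Type*} (p e : ℕ) (D : ℕ → M → M) (v : Fin e → ℕ) :
    hsComp p e D v = familyComp (fun m n => (D n)^[p ^ (m : ℕ)]) v := rfl

theorem familyComp_add {e : ℕ} {E : Fin e → ℕ → R → R} (hE : ∀ m, IsHS (E m)) (v : Fin e → ℕ)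
    (x y : R) : familyComp E v (x + y) = familyComp E v x + familyComp E v y := by
  induction e with
  | zero => rfl
  | succ e ih => rw [familyComp_succ, familyComp_succ, familyComp_succ, ih fun m => hE m.succ,
      (hE 0).add]

theorem familyComp_mul {e : ℕ} {E : Fin e → ℕ → R → R} (hE : ∀ m, IsHS (E m)) (v : Fin e →₀ ℕ)
    (x y : R) : familyComp E v (x * y)
      = ∑ a ∈ antidiagonal v, familyComp E a.1 x * familyComp E a.2 y := by
  induction e with
  | zero =>
    have : antidiagonal v = {(0, 0)} := by
      ext a
      rw [Finset.HasAntidiagonal.mem_antidiagonal, Finset.mem_singleton]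
      exact iff_of_true (Subsingleton.elim _ _) (Subsingleton.elim _ _)
    rw [this, Finset.sum_singleton]
    rfl
  | succ e ih =>
    have hv := ih (fun m => hE m.succ) v.tail
    have hE0 : ∀ n, E 0 n = (hE 0).addHom n := fun n => rfl
    rw [familyComp_succ]
    have hv' : (fun m : Fin e => v m.succ) = v.tail := rfl
    rw [hv', hv, hE0, _root_.map_sum]
    simp only [addHom_apply, (hE 0).mul]
    rw [Finset.sum_comm, ← Finset.sum_product']
    refine Finset.sum_nbij' (fun q => (Finsupp.cons q.1.1 q.2.1, Finsupp.cons q.1.2 q.2.2))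
      (fun a => ((a.1 0, a.2 0), (a.1.tail, a.2.tail))) ?_ ?_ ?_ ?_ ?_
    · rintro ⟨⟨a, b⟩, u, w⟩ hq
      simp only [Finset.mem_product, Finset.HasAntidiagonal.mem_antidiagonal] at hq ⊢
      ext m
      refine Fin.cases ?_ (fun m => ?_) m
      · simpa using hq.1
      · simpa [Finsupp.tail_apply] using DFunLike.congr_fun hq.2 m
    · rintro ⟨u, w⟩ hq
      simp only [Finset.mem_product, Finset.HasAntidiagonal.mem_antidiagonal] at hq ⊢
      subst hq
      exact ⟨rfl, by ext m; simp [Finsupp.tail_apply]⟩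
    · rintro ⟨⟨a, b⟩, u, w⟩ _
      simp
    · rintro ⟨u, w⟩ _
      simp
    · rintro ⟨⟨a, b⟩, u, w⟩ _
      rw [familyComp_succ, familyComp_succ]
      simp

theorem familyComp_zero {M : Type*} {e : ℕ} {E : Fin e → ℕ → M → M}
    (h0 : ∀ m x, E m 0 x = x) (x : M) : familyComp E 0 x = x := by
  induction e with
  | zero => rfl
  | succ e ih => rw [familyComp_succ]; exact (h0 0 _).trans (ih fun m x => h0 m.succ x)

theorem familyComp_one {e : ℕ} {E : Fin e → ℕ → R → R} (hE : ∀ m, IsHS (E m)) (v : Fin e → ℕ)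
    (hv : v ≠ 0) : familyComp E v 1 = 0 := by
  induction e with
  | zero => exact absurd (Subsingleton.elim _ _) hv
  | succ e ih =>
    rw [familyComp_succ]
    by_cases h : (fun m : Fin e => v m.succ) = 0
    · rw [h, familyComp_zero fun m => (hE m.succ).zero, (hE 0).one_eq_zero]
      by_contra h0
      refine hv (funext fun m => Fin.cases ?_ (fun m => congrFun h m) m)
      simp only [Pi.zero_apply]
      omega
    · rw [ih (fun m => hE m.succ) _ h, (hE 0).map_zero]

theorem familyComp_map_zero {e : ℕ} {E : Fin e → ℕ → R → R} (hE : ∀ m, IsHS (E m))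
    (v : Fin e → ℕ) : familyComp E v 0 = 0 := by
  simpa using familyComp_add hE v 0 0

/-- The Taylor homomorphism of a finite family of Hasse–Schmidt derivations. -/
def familyHom {e : ℕ} {E : Fin e → ℕ → R → R} (hE : ∀ m, IsHS (E m)) :
    R →+* MvPowerSeries (Fin e) R where
  toFun x v := familyComp E v x
  map_one' := by
    ext v
    rw [MvPowerSeries.coeff_one]
    split_ifs with hv
    · rw [hv]
      exact familyComp_zero (fun m => (hE m).zero) 1
    · exact familyComp_one hE v fun h => hv (DFunLike.coe_injective h)
  map_zero' := by ext v; exact familyComp_map_zero hE v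
  map_add' x y := by ext v; exact familyComp_add hE v x y
  map_mul' x y := by
    refine MvPowerSeries.ext fun v => ?_
    refine (familyComp_mul hE v x y).trans (Eq.symm ?_)
    exact MvPowerSeries.coeff_mul v _ _

/-- The Taylor homomorphism with components `hsComp p e D v`. -/
def taylor (h : IsHS D) {p : ℕ} (hp : p.Prime) [CharP R p]
    (hcomm : ∀ i j x, D i (D j x) = D j (D i x)) (e : ℕ) : R →+* MvPowerSeries (Fin e) R :=
  familyHom (E := fun m n => (D n)^[p ^ (m : ℕ)]) fun m => h.iterate_prime_pow hp hcomm m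

theorem coeff_taylor (h : IsHS D) {p : ℕ} (hp : p.Prime) [CharP R p]
    (hcomm : ∀ i j x, D i (D j x) = D j (D i x)) (e : ℕ) (v : Fin e →₀ ℕ) (x : R) :
    MvPowerSeries.coeff v (h.taylor hp hcomm e x) = hsComp p e D v x := rfl

end IsHS

/-- The composite attached to a multi-index concentrated at the first entry. -/
theorem hsComp_single_zero {M : Type*} (p e : ℕ) (he : 1 ≤ e) {D : ℕ → M → M}
    (h0 : ∀ x, D 0 x = x) (n : ℕ) (x : M) :
    hsComp p e D (Finsupp.single (⟨0, he⟩ : Fin e) n) x = D n x := by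
  obtain ⟨e, rfl⟩ : ∃ f, e = f + 1 := ⟨e - 1, by omega⟩
  rw [IsHS.hsComp_eq_familyComp, IsHS.familyComp_succ]
  have h1 : (fun m : Fin e => (Finsupp.single (⟨0, he⟩ : Fin (e + 1)) n) m.succ) = 0 := by
    funext m
    exact Finsupp.single_eq_of_ne (Fin.succ_ne_zero m)
  rw [h1, IsHS.familyComp_zero (E := fun (m : Fin e) n => (D n)^[p ^ (m.succ : ℕ)])
    fun m x => Function.iterate_fixed (h0 x) _]
  have h2 : (Finsupp.single (⟨0, he⟩ : Fin (e + 1)) n) 0 = n := Finsupp.single_eq_same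
  rw [h2]
  simp

section WittAction

open MvPolynomial

variable {p : ℕ} [Fact p.Prime] {e : ℕ}

/-- The `m`-th variable, or zero if there is none. -/
def wvar (e : ℕ) (R : Type*) [CommRing R] (m : ℕ) : MvPolynomial (Fin e) R :=
  if h : m < e then X ⟨m, h⟩ else 0

theorem wvar_fin {R : Type*} [CommRing R] (m : Fin e) : wvar e R m = X m := by
  simp [wvar]

variable (p) in
/-- The generic Witt vector of length `e`. -/
def wgen (e : ℕ) (R : Type*) [CommRing R] : WittVector p (MvPolynomial (Fin e) R) :=
  WittVector.mk p (wvar e R)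

theorem wgen_coeff {R : Type*} [CommRing R] (m : ℕ) : (wgen p e R).coeff m = wvar e R m := rfl

variable {K : Type*} [CommRing K]

/-- Evaluation of polynomials at the first `e` components of a Witt vector. -/
def wev {S : Type*} [CommRing S] [Algebra K S] (x : WittVector p S) :
    MvPolynomial (Fin e) K →ₐ[K] S :=
  aeval fun m : Fin e => x.coeff m

@[simp] theorem wev_X {S : Type*} [CommRing S] [Algebra K S] (x : WittVector p S) (m : Fin e) :
    wev x (X m : MvPolynomial (Fin e) K) = x.coeff m := aeval_X _ _

theorem wev_congr {S : Type*} [CommRing S] [Algebra K S] {x y : WittVector p S}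
    (h : WittVector.truncate e x = WittVector.truncate e y) :
    (wev x : MvPolynomial (Fin e) K →ₐ[K] S) = wev y := by
  refine algHom_ext fun m => ?_
  rw [wev_X, wev_X, ← WittVector.coeff_truncate, h, WittVector.coeff_truncate]

theorem map_wev {S T : Type*} [CommRing S] [Algebra K S] [CommRing T] [Algebra K T]
    (φ : S →ₐ[K] T) (x : WittVector p S) :
    φ.comp (wev x) = (wev (WittVector.map (φ : S →+* T) x) : MvPolynomial (Fin e) K →ₐ[K] T) := by
  refine algHom_ext fun m => ?_
  rw [AlgHom.comp_apply, wev_X, wev_X, WittVector.map_coeff]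
  rfl

theorem truncate_eq_of {S : Type*} [CommRing S] {x y : WittVector p S}
    (h : ∀ m, m < e → x.coeff m = y.coeff m) :
    WittVector.truncate e x = WittVector.truncate e y := by
  ext m
  rw [WittVector.coeff_truncate, WittVector.coeff_truncate, h m m.2]

theorem wev_wgen : (wev (wgen p e K) : MvPolynomial (Fin e) K →ₐ[K] _) = AlgHom.id _ _ := by
  refine algHom_ext fun m => ?_
  rw [wev_X, wgen_coeff, wvar_fin]
  rfl

theorem truncate_map_wgen {S : Type*} [CommRing S] (φ : MvPolynomial (Fin e) K →+* S)
    (x : WittVector p S) (h : ∀ m : Fin e, φ (X m) = x.coeff m) :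
    WittVector.truncate e (WittVector.map φ (wgen p e K)) = WittVector.truncate e x := by
  refine truncate_eq_of fun m hm => ?_
  rw [WittVector.map_coeff, wgen_coeff, ← h ⟨m, hm⟩, ← wvar_fin]

variable (p) in
/-- The sum of the two generic Witt vectors. -/
def wsum (e : ℕ) (K : Type*) [CommRing K] :
    WittVector p (MvPolynomial (Fin e) (MvPolynomial (Fin e) K)) :=
  WittVector.map C (wgen p e K) + wgen p e (MvPolynomial (Fin e) K)

variable (p) in
/-- Translation by a generic Witt vector. -/
def wtrans (e : ℕ) (K : Type*) [CommRing K] :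
    MvPolynomial (Fin e) K →ₐ[K] MvPolynomial (Fin e) (MvPolynomial (Fin e) K) :=
  wev (wsum p e K)

variable (p) in
/-- The operators of the regular action of the Witt group on polynomials. -/
def wop (j : Fin e →₀ ℕ) (r : MvPolynomial (Fin e) K) : MvPolynomial (Fin e) K :=
  coeff j (wtrans p e K r)

theorem wop_zero (r : MvPolynomial (Fin e) K) : wop p 0 r = r := by
  let ε : MvPolynomial (Fin e) (MvPolynomial (Fin e) K) →ₐ[K] MvPolynomial (Fin e) K :=
    (aeval (0 : Fin e → MvPolynomial (Fin e) K)).restrictScalars K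
  have hε : ∀ q, ε q = coeff 0 q := fun q => aeval_zero q
  have h : ε.comp (wtrans p e K) = AlgHom.id K _ := by
    rw [wtrans, map_wev, ← wev_wgen (p := p) (e := e) (K := K)]
    congr 1
    rw [wsum, map_add]
    have h1 : WittVector.map (ε : _ →+* MvPolynomial (Fin e) K) (wgen p e (MvPolynomial (Fin e) K)) = 0 := by
      ext m : 1
      rw [WittVector.map_coeff, wgen_coeff, WittVector.zero_coeff, wvar]
      split_ifs with h
      · exact (hε _).trans (coeff_zero_X _)
      · simp
    rw [h1, add_zero]
    ext m : 1
    rw [WittVector.map_coeff, WittVector.map_coeff]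
    exact (hε _).trans (coeff_zero_C _)
  exact (hε _).symm.trans (DFunLike.congr_fun h r)

theorem xyExp_apply_zero (i j : Fin e → ℕ) (m : Fin e) : xyExp e i j (0, (m : ℕ)) = i m := by
  rw [xyExp, Finsupp.finsetSum_apply, Finset.sum_eq_single m]
  · simp
  · intro b _ hb
    have : (b : ℕ) ≠ m := fun h => hb (Fin.ext h)
    simp [this]
  · simp

theorem xyExp_apply_one (i j : Fin e → ℕ) (m : Fin e) : xyExp e i j (1, (m : ℕ)) = j m := by
  rw [xyExp, Finsupp.finsetSum_apply, Finset.sum_eq_single m]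
  · simp
  · intro b _ hb
    have : (b : ℕ) ≠ m := fun h => hb (Fin.ext h)
    simp [this]
  · simp

theorem xyExp_apply_of_le (i j : Fin e → ℕ) (b : Fin 2) {m : ℕ} (h : e ≤ m) :
    xyExp e i j (b, m) = 0 := by
  rw [xyExp, Finsupp.finsetSum_apply, Finset.sum_eq_zero]
  intro c _
  have : (c : ℕ) ≠ m := fun h => by omega
  simp [this]

theorem xyExp_eq_iff (i j : Fin e → ℕ) (s : (Fin 2 × ℕ) →₀ ℕ) :
    xyExp e i j = s ↔ (∀ m : Fin e, i m = s (0, (m : ℕ))) ∧ (∀ m : Fin e, j m = s (1, (m : ℕ))) ∧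
      ∀ b m, e ≤ m → s (b, m) = 0 := by
  constructor
  · rintro rfl
    exact ⟨fun m => (xyExp_apply_zero i j m).symm, fun m => (xyExp_apply_one i j m).symm,
      fun b m => xyExp_apply_of_le i j b⟩
  · rintro ⟨h0, h1, h2⟩
    ext ⟨b, m⟩
    by_cases hm : m < e
    · fin_cases b
      · exact (xyExp_apply_zero i j ⟨m, hm⟩).trans (h0 _)
      · exact (xyExp_apply_one i j ⟨m, hm⟩).trans (h1 _)
    · rw [xyExp_apply_of_le i j b (not_lt.mp hm), h2 b m (not_lt.mp hm)]

variable [CharP K p]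

variable (p) in
/-- The ring homomorphism sending the variables to the two families of generic variables. -/
def wpair (e : ℕ) (K : Type*) [CommRing K] [CharP K p] :
    MvPolynomial (Fin 2 × ℕ) (ZMod p) →+* MvPolynomial (Fin e) (MvPolynomial (Fin e) K) :=
  eval₂Hom (ZMod.castHom (dvd_refl p) _)
    (Function.uncurry ![fun m => C (wvar e K m), wvar e (MvPolynomial (Fin e) K)])

theorem xyExp_tsub_left (i j : Fin e →₀ ℕ) (m : Fin e) :
    xyExp e i j - Finsupp.single (0, (m : ℕ)) 1 = xyExp e (i - Finsupp.single m 1 : Fin e →₀ ℕ) j := by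
  refine ((xyExp_eq_iff _ _ _).2 ⟨fun n => ?_, fun n => ?_, fun b n hn => ?_⟩).symm
  · rw [Finsupp.tsub_apply, Finsupp.tsub_apply, xyExp_apply_zero, Finsupp.single_apply,
      Finsupp.single_apply]
    simp [Fin.ext_iff]
  · rw [Finsupp.tsub_apply, xyExp_apply_one, Finsupp.single_apply]
    simp
  · rw [Finsupp.tsub_apply, xyExp_apply_of_le _ _ _ hn, Nat.zero_sub]

theorem xyExp_tsub_right (i j : Fin e →₀ ℕ) (m : Fin e) :
    xyExp e i j - Finsupp.single (1, (m : ℕ)) 1 = xyExp e i (j - Finsupp.single m 1 : Fin e →₀ ℕ) := by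
  refine ((xyExp_eq_iff _ _ _).2 ⟨fun n => ?_, fun n => ?_, fun b n hn => ?_⟩).symm
  · rw [Finsupp.tsub_apply, xyExp_apply_zero, Finsupp.single_apply]
    simp
  · rw [Finsupp.tsub_apply, Finsupp.tsub_apply, xyExp_apply_one, Finsupp.single_apply,
      Finsupp.single_apply]
    simp [Fin.ext_iff]
  · rw [Finsupp.tsub_apply, xyExp_apply_of_le _ _ _ hn, Nat.zero_sub]

theorem coeff_wpair (g : MvPolynomial (Fin 2 × ℕ) (ZMod p)) (i j : Fin e →₀ ℕ) :
    coeff i (coeff j (wpair p e K g)) = ZMod.cast (coeff (xyExp e i j) g) := by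
  classical
  induction g using MvPolynomial.induction_on generalizing i j with
  | C a =>
    have h : wpair p e K (C a) = C (C (ZMod.cast a)) := by
      rw [wpair, coe_eval₂Hom, eval₂_C]
      exact DFunLike.congr_fun (Subsingleton.elim (ZMod.castHom (dvd_refl p)
        (MvPolynomial (Fin e) (MvPolynomial (Fin e) K)))
        ((C.comp C).comp (ZMod.castHom (dvd_refl p) K))) a
    rw [h, coeff_C, coeff_C]
    by_cases hj : 0 = j
    · rw [if_pos hj, coeff_C]
      by_cases hi : 0 = i
      · subst hi hj
        have : (0 : (Fin 2 × ℕ) →₀ ℕ) = xyExp e (0 : Fin e →₀ ℕ) (0 : Fin e →₀ ℕ) := by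
          symm; simp [xyExp_eq_iff]
        rw [if_pos rfl, if_pos this]
      · rw [if_neg hi, if_neg, ZMod.cast_zero]
        intro h
        rw [eq_comm, xyExp_eq_iff] at h
        exact hi (Finsupp.ext fun m => (h.1 m).symm)
    · rw [if_neg hj, if_neg, ZMod.cast_zero, coeff_zero]
      intro h
      rw [eq_comm, xyExp_eq_iff] at h
      exact hj (Finsupp.ext fun m => (h.2.1 m).symm)
  | add g h hg hh =>
    rw [map_add, coeff_add, coeff_add, coeff_add, hg, hh, ZMod.cast_add (dvd_refl p)]
  | mul_X g b ih =>
    obtain ⟨b, m⟩ := b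
    rw [map_mul, coeff_mul_X']
    by_cases hm : m < e
    · have hX : wpair p e K (X (b, m)) = ![C (X ⟨m, hm⟩), X ⟨m, hm⟩] b := by
        rw [wpair, coe_eval₂Hom, eval₂_X, Function.uncurry_apply_pair]
        fin_cases b <;> simp [wvar, hm]
      rw [hX]
      fin_cases b
      · have : ((0 : Fin 2), m) ∈ (xyExp e i j).support ↔ (⟨m, hm⟩ : Fin e) ∈ i.support := by
          rw [Finsupp.mem_support_iff, Finsupp.mem_support_iff, ← xyExp_apply_zero i j ⟨m, hm⟩]
        rw [mul_comm]
        simp only [Fin.zero_eta, Matrix.cons_val_zero, this, coeff_C_mul]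
        rw [mul_comm, coeff_mul_X']
        split_ifs
        · rw [ih]
          congr 2
          exact (xyExp_tsub_left i j ⟨m, hm⟩).symm
        · rw [ZMod.cast_zero]
      · have : ((1 : Fin 2), m) ∈ (xyExp e i j).support ↔ (⟨m, hm⟩ : Fin e) ∈ j.support := by
          rw [Finsupp.mem_support_iff, Finsupp.mem_support_iff, ← xyExp_apply_one i j ⟨m, hm⟩]
        simp only [Fin.mk_one, Matrix.cons_val_one, Matrix.cons_val_fin_one, this, coeff_mul_X']
        split_ifs
        · rw [ih]
          congr 2
          exact (xyExp_tsub_right i j ⟨m, hm⟩).symm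
        · rw [ZMod.cast_zero, coeff_zero]
    · have hX : wpair p e K (X (b, m)) = 0 := by
        rw [wpair, coe_eval₂Hom, eval₂_X, Function.uncurry_apply_pair]
        fin_cases b <;> simp [wvar, hm]
      rw [hX, mul_zero, coeff_zero, coeff_zero, if_neg, ZMod.cast_zero]
      rw [Finsupp.mem_support_iff, xyExp_apply_of_le i j b (not_lt.mp hm)]
      exact fun h => h rfl

theorem wpair_wittHmod (m : ℕ) : wpair p e K (wittHmod p m) = (wsum p e K).coeff m := by
  rw [wsum, WittVector.add_coeff, WittVector.peval, wittHmod, wpair, coe_eval₂Hom, eval₂_map,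
    aeval_def]
  congr 1
  exact Subsingleton.elim _ _

theorem coeff_prod_wsum (l : Fin e → ℕ) (i j : Fin e →₀ ℕ) :
    coeff i (coeff j (∏ m : Fin e, (wsum p e K).coeff m ^ l m)) =
      ZMod.cast (wittAlpha p e i j l) := by
  rw [wittAlpha, ← coeff_wpair, map_prod]
  simp only [map_pow, wpair_wittHmod]

theorem wtrans_X (m : Fin e) : wtrans p e K (X m) = (wsum p e K).coeff m := wev_X _ _

theorem truncate_map_wtrans :
    WittVector.truncate e (WittVector.map (wtrans p e K : _ →+* _) (wgen p e K)) =
      WittVector.truncate e (wsum p e K) :=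
  truncate_map_wgen _ _ fun m => wtrans_X m

/-- The operators compose according to the structure constants of the Witt group. -/
theorem wop_wop (i j : Fin e →₀ ℕ) (r : MvPolynomial (Fin e) K) :
    wop p i (wop p j r) =
      ∑ l ∈ (wtrans p e K r).support, ZMod.cast (wittAlpha p e i j l) * wop p l r := by
  let E : (MvPolynomial (Fin e) K) →ₐ[K] MvPolynomial (Fin e) (MvPolynomial (Fin e) K) := wtrans p e K
  let G : MvPolynomial (Fin e) (MvPolynomial (Fin e) K) →ₐ[K] MvPolynomial (Fin e) (MvPolynomial (Fin e) (MvPolynomial (Fin e) K)) :=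
    mapAlgHom E
  let H : MvPolynomial (Fin e) (MvPolynomial (Fin e) K) →ₐ[K] MvPolynomial (Fin e) (MvPolynomial (Fin e) (MvPolynomial (Fin e) K)) :=
    AlgHom.restrictScalars K (wev (wsum p e (MvPolynomial (Fin e) K)) :
      MvPolynomial (Fin e) (MvPolynomial (Fin e) K) →ₐ[(MvPolynomial (Fin e) K)] MvPolynomial (Fin e) (MvPolynomial (Fin e) (MvPolynomial (Fin e) K)))
  have hG : ∀ q, G q = map (E : (MvPolynomial (Fin e) K) →+* _) q := fun q => rfl
  have hH : ∀ q : MvPolynomial (Fin e) (MvPolynomial (Fin e) K), H q =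
      ∑ l ∈ q.support, C (C (coeff l q)) * ∏ m : Fin e, (wsum p e (MvPolynomial (Fin e) K)).coeff m ^ l m := by
    intro q
    change aeval _ q = _
    rw [aeval_def, eval₂_eq']
    rfl
  have key : G.comp E = H.comp E := by
    refine (map_wev (p := p) G _).trans ((wev_congr ?_).trans (map_wev (p := p)
      (S := MvPolynomial (Fin e) (MvPolynomial (Fin e) K))
      (T := MvPolynomial (Fin e) (MvPolynomial (Fin e) (MvPolynomial (Fin e) K))) H _).symm)
    have h1 : WittVector.map (G : MvPolynomial (Fin e) (MvPolynomial (Fin e) K) →+*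
          MvPolynomial (Fin e) (MvPolynomial (Fin e) (MvPolynomial (Fin e) K)))
        (WittVector.map C (wgen p e K)) =
        WittVector.map C (WittVector.map (E : (MvPolynomial (Fin e) K) →+* _) (wgen p e K)) := by
      ext m : 1
      simp only [WittVector.map_coeff]
      exact map_C _ _
    have h2 : WittVector.map (G : MvPolynomial (Fin e) (MvPolynomial (Fin e) K) →+*
          MvPolynomial (Fin e) (MvPolynomial (Fin e) (MvPolynomial (Fin e) K)))
        (wgen p e (MvPolynomial (Fin e) K)) = wgen p e _ := by
      ext m : 1
      rw [WittVector.map_coeff, wgen_coeff, wgen_coeff, wvar, wvar]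
      split_ifs with h
      · exact map_X _ _
      · exact map_zero _
    have h3 : WittVector.map (H : MvPolynomial (Fin e) (MvPolynomial (Fin e) K) →+*
          MvPolynomial (Fin e) (MvPolynomial (Fin e) (MvPolynomial (Fin e) K)))
        (WittVector.map C (wgen p e K)) =
        WittVector.map C (WittVector.map C (wgen p e K)) := by
      ext m : 1
      simp only [WittVector.map_coeff]
      exact (algHom_C (wev (wsum p e (MvPolynomial (Fin e) K)) :
        MvPolynomial (Fin e) (MvPolynomial (Fin e) K) →ₐ[MvPolynomial (Fin e) K] _) _)
    have h4 : WittVector.truncate e (WittVector.map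
        (H : MvPolynomial (Fin e) (MvPolynomial (Fin e) K) →+*
          MvPolynomial (Fin e) (MvPolynomial (Fin e) (MvPolynomial (Fin e) K))) (wgen p e (MvPolynomial (Fin e) K))) =
        WittVector.truncate e (wsum p e (MvPolynomial (Fin e) K)) :=
      truncate_map_wgen _ _ fun m =>
        wev_X (K := MvPolynomial (Fin e) K) (wsum p e (MvPolynomial (Fin e) K)) m
    have h5 : WittVector.truncate e (WittVector.map (S := MvPolynomial (Fin e)
          (MvPolynomial (Fin e) (MvPolynomial (Fin e) K))) C
          (WittVector.map (E : (MvPolynomial (Fin e) K) →+* _) (wgen p e K)))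
        = WittVector.truncate e (WittVector.map (S := MvPolynomial (Fin e)
          (MvPolynomial (Fin e) (MvPolynomial (Fin e) K))) C
          (wsum p e K)) := by
      refine truncate_eq_of fun m hm => ?_
      rw [WittVector.map_coeff, WittVector.map_coeff]
      congr 1
      have := congrArg (TruncatedWittVector.coeff ⟨m, hm⟩) (truncate_map_wtrans (p := p) (K := K))
      rwa [WittVector.coeff_truncate, WittVector.coeff_truncate] at this
    rw [wsum, map_add, map_add, map_add, map_add, h1, h2, h3, h4, h5, wsum, map_add, map_add, wsum,
      map_add]
    exact add_assoc (G := TruncatedWittVector p e (MvPolynomial (Fin e)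
      (MvPolynomial (Fin e) (MvPolynomial (Fin e) K)))) _ _ _
  have h := congrArg (fun q => coeff i (coeff j q)) (DFunLike.congr_fun key r)
  simp only [AlgHom.comp_apply, hG, hH, coeff_map, coeff_sum, coeff_C_mul, coeff_prod_wsum] at h
  refine h.trans (Finset.sum_congr rfl fun l _ => mul_comm _ _)

theorem wittAlpha_comm (i j l : Fin e → ℕ) : wittAlpha p e i j l = wittAlpha p e j i l := by
  let f : Fin 2 × ℕ → Fin 2 × ℕ := Prod.map (Equiv.swap 0 1) id
  have hf : Function.Injective f :=
    Function.Injective.prodMap (Equiv.injective _) Function.injective_id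
  have hH : ∀ m, rename f (wittHmod p m) = wittHmod p m := by
    intro m
    let R := MvPolynomial (Fin 2 × ℕ) (ZMod p)
    let x : Fin 2 → WittVector p R := fun b => WittVector.mk p fun m => X (b, m)
    have hx : ∀ a b, (x a + x b).coeff m =
        eval₂ (Int.castRingHom R) (Function.uncurry ![fun m => X (a, m), fun m => X (b, m)])
          (WittVector.wittAdd p m) := fun a b => by
      rw [WittVector.add_coeff, WittVector.peval, aeval_def]
      rfl
    have h1 : wittHmod p m = (x 0 + x 1).coeff m := by
      rw [hx, wittHmod]
      have : (Function.uncurry ![fun m => X ((0 : Fin 2), m), fun m => X (1, m)] :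
          Fin 2 × ℕ → R) = X := by
        ext1 ⟨b, n⟩; fin_cases b <;> rfl
      rw [this, ← eval₂_eta (map _ _), eval₂_map]
      congr 1
    have h2 : rename f (wittHmod p m) = (x 1 + x 0).coeff m := by
      rw [hx, wittHmod, ← map_rename, ← eval₂_eta (map _ _), eval₂_map, eval₂_rename]
      congr 1
      ext1 ⟨b, n⟩; fin_cases b <;> simp [f]
    rw [h2, add_comm, h1]
  have hE : Finsupp.mapDomain f (xyExp e i j) = xyExp e j i := by
    rw [xyExp, xyExp, Finsupp.mapDomain_finsetSum]
    refine Finset.sum_congr rfl fun m _ => ?_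
    rw [Finsupp.mapDomain_add, Finsupp.mapDomain_single, Finsupp.mapDomain_single, add_comm]
    simp [f]
  rw [wittAlpha, ← coeff_rename_mapDomain f hf, hE, map_prod, wittAlpha]
  simp only [map_pow, hH]

theorem wop_comm (i j : Fin e →₀ ℕ) (r : MvPolynomial (Fin e) K) :
    wop p i (wop p j r) = wop p j (wop p i r) := by
  rw [wop_wop, wop_wop]
  exact Finset.sum_congr rfl fun l _ => by rw [wittAlpha_comm]

theorem wittHmod_eq (m : ℕ) : wittHmod p m =
    (WittVector.mk p (fun n => (X (0, n) : MvPolynomial (Fin 2 × ℕ) (ZMod p))) +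
      WittVector.mk p (fun n => X (1, n))).coeff m := by
  rw [WittVector.add_coeff, WittVector.peval, aeval_def, wittHmod,
    ← eval₂_eta (map _ _), eval₂_map]
  congr 1
  ext1 ⟨b, n⟩; fin_cases b <;> rfl

/-- Structure constants for multi-indices with separated supports. -/
theorem wittAlpha_of_separated (k : ℕ) (i j : Fin e →₀ ℕ) (hi : ∀ m : Fin e, k < m → i m = 0)
    (hj : ∀ m : Fin e, (m : ℕ) ≤ k → j m = 0) (l : Fin e →₀ ℕ) :
    wittAlpha p e i j l = if l = i + j then 1 else 0 := by
  let f : Fin e → Fin 2 × ℕ := fun m => (if (m : ℕ) ≤ k then 0 else 1, m)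
  have hf : Function.Injective f := fun a b hab => Fin.ext (Prod.ext_iff.1 hab).2
  have hE : Finsupp.mapDomain f (i + j) = xyExp e i j := by
    refine ((xyExp_eq_iff _ _ _).2 ⟨fun m => ?_, fun m => ?_, fun b m hm => ?_⟩).symm
    · by_cases h : (m : ℕ) ≤ k
      · have : ((0 : Fin 2), (m : ℕ)) = f m := by simp [f, h]
        rw [this, Finsupp.mapDomain_apply hf, Finsupp.add_apply, hj m h, add_zero]
      · rw [Finsupp.mapDomain_of_notMem_range, hi m (by omega)]
        rintro ⟨m', hm'⟩
        have := Fin.ext (Prod.ext_iff.1 hm').2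
        subst this
        simp [f, h] at hm'
    · by_cases h : (m : ℕ) ≤ k
      · rw [Finsupp.mapDomain_of_notMem_range, hj m h]
        rintro ⟨m', hm'⟩
        have := Fin.ext (Prod.ext_iff.1 hm').2
        subst this
        simp [f, h] at hm'
      · have : ((1 : Fin 2), (m : ℕ)) = f m := by simp [f, h]
        rw [this, Finsupp.mapDomain_apply hf, Finsupp.add_apply, hi m (by omega), zero_add]
    · rw [Finsupp.mapDomain_of_notMem_range]
      rintro ⟨m', hm'⟩
      have := (Prod.ext_iff.1 hm').2
      simp only [f] at this
      omega
  have hH : ∀ m : Fin e, killCompl hf (wittHmod p m) = (X m : MvPolynomial (Fin e) (ZMod p)) := by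
    intro m
    have hk : ∀ m : Fin e, killCompl hf (X (f m)) = (X m : MvPolynomial (Fin e) (ZMod p)) :=
      fun m => by
        have := killCompl_rename_app hf (X m : MvPolynomial (Fin e) (ZMod p))
        rwa [rename_X] at this
    have hk0 : ∀ s, s ∉ Set.range f → killCompl hf (X s : MvPolynomial _ (ZMod p)) = 0 := by
      intro s hs
      rw [killCompl, aeval_X, dif_neg hs]
    rw [wittHmod_eq, ← RingHom.coe_coe, ← WittVector.map_coeff, map_add,
      WittVector.coeff_add_of_disjoint]
    · simp only [WittVector.map_coeff, WittVector.coeff_mk, RingHom.coe_coe]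
      by_cases h : (m : ℕ) ≤ k
      · have h0 : ((0 : Fin 2), (m : ℕ)) = f m := by simp [f, h]
        rw [h0, hk, hk0, add_zero]
        rintro ⟨m', hm'⟩
        have := Fin.ext (Prod.ext_iff.1 hm').2
        subst this
        simp [f, h] at hm'
      · have h0 : ((1 : Fin 2), (m : ℕ)) = f m := by simp [f, h]
        rw [h0, hk, hk0, zero_add]
        rintro ⟨m', hm'⟩
        have := Fin.ext (Prod.ext_iff.1 hm').2
        subst this
        simp [f, h] at hm'
    · intro n
      simp only [WittVector.map_coeff, WittVector.coeff_mk, RingHom.coe_coe]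
      by_cases h : n ≤ k
      · right
        refine hk0 _ ?_
        rintro ⟨m', hm'⟩
        have := (Prod.ext_iff.1 hm').2
        simp only [f] at this
        subst this
        simp [f, h] at hm'
      · left
        refine hk0 _ ?_
        rintro ⟨m', hm'⟩
        have := (Prod.ext_iff.1 hm').2
        simp only [f] at this
        subst this
        simp [f, h] at hm'
  rw [wittAlpha, ← hE, ← coeff_killCompl hf, map_prod]
  simp only [map_pow, hH]
  have : (∏ m : Fin e, X m ^ l m : MvPolynomial (Fin e) (ZMod p)) = monomial l 1 := by
    rw [monomial_eq, Finsupp.prod_fintype _ _ (fun _ => pow_zero _), C_1, one_mul]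
  rw [this, coeff_monomial]

theorem wop_wop_of_separated (k : ℕ) (i j : Fin e →₀ ℕ) (hi : ∀ m : Fin e, k < m → i m = 0)
    (hj : ∀ m : Fin e, (m : ℕ) ≤ k → j m = 0) (r : MvPolynomial (Fin e) K) :
    wop p i (wop p j r) = wop p (i + j) r := by
  rw [wop_wop]
  simp only [wittAlpha_of_separated k i j hi hj]
  rw [Finset.sum_eq_single (i + j)]
  · rw [if_pos rfl, ZMod.cast_one (dvd_refl p), one_mul]
  · intro l _ hl
    rw [if_neg hl, ZMod.cast_zero, zero_mul]
  · intro h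
    rw [wop, notMem_support_iff.1 h, mul_zero]

end WittAction

theorem PowerSeries.coeff_mk_pow_prime {S : Type*} [Ring S] {p : ℕ} (hp : p.Prime)
    (h0 : (p : S) = 0) (d : ℕ → S) (hc : ∀ a b, Commute (d a) (d b)) (n : ℕ) :
    PowerSeries.coeff (p * n) (PowerSeries.mk d ^ p) = d n ^ p := by
  have hmon : ∀ (a m : ℕ) (s : S),
      PowerSeries.monomial a s ^ m = PowerSeries.monomial (m * a) (s ^ m) := by
    intro a m s
    induction m with
    | zero => simp
    | succ m ih =>
      rw [pow_succ, ih, PowerSeries.monomial_mul_monomial, ← pow_succ, Nat.succ_mul]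
  set N := p * n with hN
  have hdec : PowerSeries.mk d = ∑ a ∈ Finset.range (N + 1), PowerSeries.monomial a (d a) +
      PowerSeries.mk (fun a => d (a + (N + 1))) * PowerSeries.X ^ (N + 1) := by
    ext a
    rw [map_add, map_sum, PowerSeries.coeff_mul_X_pow', PowerSeries.coeff_mk]
    simp only [PowerSeries.coeff_monomial, PowerSeries.coeff_mk]
    by_cases ha : a < N + 1
    · rw [Finset.sum_ite_eq, if_pos (Finset.mem_range.2 ha), if_neg (by omega), add_zero]
    · rw [Finset.sum_ite_eq, if_neg (by simpa using ha), if_pos (by omega), zero_add,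
        Nat.sub_add_cancel (by omega)]
  have h0' : (p : PowerSeries S) = 0 := by
    rw [← map_natCast (PowerSeries.C (R := S)), h0, map_zero]
  have hmm : ∀ a b, Commute (PowerSeries.monomial a (d a)) (PowerSeries.monomial b (d b)) := by
    intro a b
    rw [commute_iff_eq, PowerSeries.monomial_mul_monomial, PowerSeries.monomial_mul_monomial,
      add_comm, (hc a b).eq]
  have hmk : ∀ a (f : ℕ → S), (∀ b, Commute (d a) (f b)) →
      Commute (PowerSeries.monomial a (d a)) (PowerSeries.mk f) := by
    intro a f hf
    ext b
    rw [PowerSeries.coeff_mul, PowerSeries.coeff_mul, ← Finset.sum_equiv (Equiv.prodComm ℕ ℕ)]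
    · intro x
      simp [add_comm]
    · intro x _
      simp only [Equiv.prodComm_apply, Prod.fst_swap, Prod.snd_swap, PowerSeries.coeff_mk,
        PowerSeries.coeff_monomial]
      split_ifs
      · exact (hf _).eq.symm ▸ rfl
      · simp
  have hX : ∀ f : PowerSeries S, Commute f (PowerSeries.X ^ (N + 1)) := fun f =>
    (PowerSeries.commute_X_pow f _)
  rw [hdec, Commute.add_pow_prime_eq hp, h0', zero_mul, zero_mul, zero_mul, add_zero, map_add,
    sum_pow_prime_of_commute hp h0' _ _ hmm, (hX _).mul_pow, map_sum, ← pow_mul,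
    PowerSeries.coeff_mul_X_pow', if_neg, add_zero]
  · simp only [hmon, PowerSeries.coeff_monomial]
    rw [Finset.sum_eq_single n]
    · rw [if_pos hN]
    · intro b _ hb
      rw [if_neg]
      intro h
      exact hb (Nat.eq_of_mul_eq_mul_left hp.pos h).symm
    · intro h
      exact absurd (Finset.mem_range.2 (Nat.lt_succ_of_le (Nat.le_mul_of_pos_left n hp.pos))) h
  · have := hp.pos
    nlinarith
  · refine Commute.sum_left _ _ _ fun a _ => Commute.mul_right (hmk a _ fun b => hc _ _) (hX _)

section WittIterate

open MvPolynomial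

variable {p : ℕ} [Fact p.Prime] {e : ℕ} {K : Type*} [CommRing K]

variable (p) in
/-- The Witt vector with one possibly nonzero component. -/
def wsingle {S : Type*} [CommRing S] (k : ℕ) (t : S) : WittVector p S :=
  WittVector.mk p fun m => if m = k then t else 0

theorem wsingle_coeff {S : Type*} [CommRing S] (k : ℕ) (t : S) (m : ℕ) :
    (wsingle p k t).coeff m = if m = k then t else 0 := rfl

theorem map_wsingle {S T : Type*} [CommRing S] [CommRing T] (f : S →+* T) (k : ℕ) (t : S) :
    WittVector.map f (wsingle p k t) = wsingle p k (f t) := by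
  ext m : 1
  rw [WittVector.map_coeff, wsingle_coeff, wsingle_coeff]
  split_ifs
  · rfl
  · exact map_zero f

theorem nsmul_wsingle {S : Type*} [CommRing S] [CharP S p] (k : ℕ) (t : S) :
    p • wsingle p k t = wsingle p (k + 1) (t ^ p) := by
  rw [nsmul_eq_mul, mul_comm]
  ext m : 1
  rw [wsingle_coeff]
  cases m with
  | zero =>
    rw [WittVector.mul_charP_coeff_zero, if_neg (by omega)]
  | succ m =>
    rw [WittVector.mul_charP_coeff_succ, wsingle_coeff]
    simp only [Nat.add_right_cancel_iff]
    split_ifs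
    · rfl
    · exact zero_pow (Fact.out (p := p.Prime)).ne_zero

variable (p) in
/-- Translation along the `k`-th component. -/
def wflow (e : ℕ) (K : Type*) [CommRing K] (k : ℕ) :
    MvPolynomial (Fin e) K →ₐ[K] Polynomial (MvPolynomial (Fin e) K) :=
  wev (WittVector.map Polynomial.C (wgen p e K) + wsingle p k Polynomial.X)

theorem wflow_X (k : ℕ) (m : Fin e) : wflow p e K k (X m) =
    (WittVector.map Polynomial.C (wgen p e K) + wsingle p k Polynomial.X).coeff m := wev_X _ _

theorem truncate_map_wflow (k : ℕ) :
    WittVector.truncate e (WittVector.map (wflow p e K k : _ →+* _) (wgen p e K)) =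
      WittVector.truncate e (WittVector.map Polynomial.C (wgen p e K) +
        wsingle p k Polynomial.X) :=
  truncate_map_wgen _ _ fun m => wflow_X k m

theorem wflow_of_le {k : ℕ} (hk : e ≤ k) (r : MvPolynomial (Fin e) K) :
    wflow p e K k r = Polynomial.C r := by
  have h : wflow p e K k = (Algebra.ofId (MvPolynomial (Fin e) K) _).restrictScalars K := by
    refine algHom_ext fun m => ?_
    have h0 : WittVector.truncate e (wsingle p k (Polynomial.X : Polynomial (MvPolynomial (Fin e) K)))
        = 0 := by
      rw [← map_zero (WittVector.truncate e)]
      refine truncate_eq_of fun m hm => ?_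
      rw [wsingle_coeff, if_neg (by omega), WittVector.zero_coeff]
    rw [wflow_X, ← WittVector.coeff_truncate, map_add, h0, add_zero, WittVector.coeff_truncate,
      WittVector.map_coeff, wgen_coeff, wvar_fin]
    rfl
  rw [h]
  rfl

theorem coeff_wflow [CharP K p] (k : Fin e) (n : ℕ) (r : MvPolynomial (Fin e) K) :
    (wflow p e K k r).coeff n = wop p (Finsupp.single k n) r := by
  let φ : MvPolynomial (Fin e) (MvPolynomial (Fin e) K) →ₐ[MvPolynomial (Fin e) K]
      Polynomial (MvPolynomial (Fin e) K) := aeval fun m => if m = k then Polynomial.X else 0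
  have hφ : ∀ q n, (φ q).coeff n = coeff (Finsupp.single k n) q := by
    intro q n
    induction q using MvPolynomial.induction_on generalizing n with
    | C a =>
      rw [show φ (C a) = Polynomial.C a from algHom_C _ _, Polynomial.coeff_C, coeff_C]
      simp [eq_comm]
    | add f g hf hg => rw [map_add, Polynomial.coeff_add, coeff_add, hf, hg]
    | mul_X f m hf =>
      rw [map_mul, show φ (X m) = _ from aeval_X _ _, coeff_mul_X']
      split_ifs with h1 h2 h2
      · subst h1
        cases n with
        | zero => simp at h2
        | succ n =>
          rw [Polynomial.coeff_mul_X, hf]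
          congr 1
          rw [← Finsupp.single_tsub, Nat.add_sub_cancel]
      · subst h1
        cases n with
        | zero => simp
        | succ n => simp at h2
      · rw [Finsupp.mem_support_iff, Finsupp.single_apply] at h2
        simp [Ne.symm h1] at h2
      · simp
  have h : (φ.restrictScalars K).comp (wtrans p e K) = wflow p e K k := by
    refine (map_wev _ _).trans (wev_congr ?_)
    rw [wsum, map_add, map_add, map_add]
    congr 1
    · congr 1
      ext m : 1
      simp only [WittVector.map_coeff]
      exact algHom_C φ _
    · refine truncate_map_wgen _ _ fun m => ?_
      rw [wsingle_coeff]
      refine (aeval_X _ _).trans ?_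
      simp [Fin.ext_iff]
  rw [← h]
  exact hφ _ _

variable (p) in
/-- The operators of translation along the `k`-th component. -/
def wder (e : ℕ) (K : Type*) [CommRing K] (k n : ℕ) : Module.End ℤ (MvPolynomial (Fin e) K) :=
  AddMonoidHom.toIntLinearMap
    ((Polynomial.lcoeff _ n).toAddMonoidHom.comp (wflow p e K k : _ →+* _).toAddMonoidHom)

theorem wder_apply (k n : ℕ) (r : MvPolynomial (Fin e) K) :
    wder p e K k n r = (wflow p e K k r).coeff n := rfl

theorem wder_commute [CharP K p] (k a b : ℕ) : Commute (wder p e K k a) (wder p e K k b) := by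
  refine LinearMap.ext fun r => ?_
  simp only [Module.End.mul_apply, wder_apply]
  by_cases hk : k < e
  · simp only [coeff_wflow (p := p) (K := K) ⟨k, hk⟩, wop_comm]
  · simp only [wflow_of_le (p := p) (K := K) (not_lt.1 hk), Polynomial.coeff_C]
    split_ifs <;> simp

theorem wder_pow [CharP K p] (k n : ℕ) (r : MvPolynomial (Fin e) K) :
    (wder p e K k n ^ p) r = wder p e K (k + 1) n r := by
  have hp : p.Prime := Fact.out
  let B := MvPolynomial (Fin e) K
  let F : Polynomial B →ₐ[K] Polynomial B :=
    { Polynomial.eval₂RingHom (wflow p e K k : B →+* Polynomial B) Polynomial.X with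
      commutes' := fun a => (Polynomial.eval₂_C _ _).trans ((wflow p e K k).commutes a) }
  have hFX : F Polynomial.X = Polynomial.X := Polynomial.eval₂_X _ _
  have hFC : ∀ b, F (Polynomial.C b) = wflow p e K k b := fun b => Polynomial.eval₂_C _ _
  have hF : ∀ q N, (F q).coeff N =
      ∑ x ∈ antidiagonal N, wder p e K k x.1 (q.coeff x.2) := by
    intro q N
    induction q using Polynomial.induction_on' with
    | add f g hf hg =>
      simp only [map_add, Polynomial.coeff_add, hf, hg, Finset.sum_add_distrib]
    | monomial a b =>
      rw [← Polynomial.C_mul_X_pow_eq_monomial, map_mul, map_pow, hFX, hFC,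
        Polynomial.coeff_mul_X_pow']
      simp only [Polynomial.coeff_C_mul_X_pow]
      split_ifs with h
      · rw [Finset.sum_eq_single (N - a, a)]
        · simp [wder_apply]
        · rintro ⟨x, y⟩ hx hne
          rw [Finset.HasAntidiagonal.mem_antidiagonal] at hx
          rw [if_neg, map_zero]
          rintro rfl
          exact hne (Prod.ext (by simp at hx ⊢; omega) rfl)
        · intro h'
          rw [Finset.HasAntidiagonal.mem_antidiagonal] at h'
          exact absurd (Nat.sub_add_cancel h) h'
      · rw [Finset.sum_eq_zero]
        rintro ⟨x, y⟩ hx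
        rw [Finset.HasAntidiagonal.mem_antidiagonal] at hx
        rw [if_neg, map_zero]
        simp at hx ⊢; omega
  have hit : ∀ m N (b : B), (F^[m] (Polynomial.C b)).coeff N =
      (PowerSeries.coeff N (PowerSeries.mk (wder p e K k) ^ m)) b := by
    intro m
    induction m with
    | zero =>
      intro N b
      rw [Function.iterate_zero, id, pow_zero, PowerSeries.coeff_one, Polynomial.coeff_C]
      split_ifs <;> rfl
    | succ m ih =>
      intro N b
      rw [Function.iterate_succ_apply', hF, pow_succ', PowerSeries.coeff_mul, LinearMap.sum_apply]
      refine Finset.sum_congr rfl fun x _ => ?_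
      rw [ih, Module.End.mul_apply, PowerSeries.coeff_mk]
  have hwev : ∀ m (b : B), F^[m] (Polynomial.C b) =
      (wev (WittVector.map Polynomial.C (wgen p e K) + m • wsingle p k Polynomial.X) :
        B →ₐ[K] Polynomial B) b := by
    intro m
    induction m with
    | zero =>
      intro b
      rw [Function.iterate_zero, id, zero_nsmul, add_zero]
      have : (wev (WittVector.map Polynomial.C (wgen p e K)) : B →ₐ[K] Polynomial B) =
          (Algebra.ofId B _).restrictScalars K := by
        refine algHom_ext fun m => ?_
        rw [wev_X, WittVector.map_coeff, wgen_coeff, wvar_fin]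
        rfl
      rw [this]
      rfl
    | succ m ih =>
      intro b
      rw [Function.iterate_succ_apply', ih]
      refine DFunLike.congr_fun ((map_wev F _).trans (wev_congr ?_)) b
      have h1 : WittVector.map (F : Polynomial B →+* Polynomial B)
          (WittVector.map Polynomial.C (wgen p e K)) =
          WittVector.map (wflow p e K k : B →+* Polynomial B) (wgen p e K) := by
        ext m : 1
        simp only [WittVector.map_coeff]
        exact hFC _
      rw [map_add, map_nsmul, h1, map_add, truncate_map_wflow, map_wsingle, ← map_add, add_assoc,
        succ_nsmul']
      erw [hFX]
  have hexp : ∀ b : B, F^[p] (Polynomial.C b) = Polynomial.expand B p (wflow p e K (k + 1) b) := by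
    intro b
    rw [hwev, nsmul_wsingle]
    have h1 : WittVector.map (((Polynomial.expand B p).restrictScalars K : Polynomial B →ₐ[K] _) :
        Polynomial B →+* Polynomial B) (WittVector.map Polynomial.C (wgen p e K)) =
        WittVector.map Polynomial.C (wgen p e K) := by
      ext m : 1
      rw [WittVector.map_coeff, WittVector.map_coeff]
      exact Polynomial.expand_C p _
    have h2 : (((Polynomial.expand B p).restrictScalars K : Polynomial B →ₐ[K] _) :
        Polynomial B →+* Polynomial B) Polynomial.X = Polynomial.X ^ p :=
      Polynomial.expand_X p
    have h3 := DFunLike.congr_fun (map_wev ((Polynomial.expand B p).restrictScalars K)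
      (WittVector.map Polynomial.C (wgen p e K) + wsingle p (k + 1) Polynomial.X)) b
    rw [map_add, map_wsingle, h1, h2] at h3
    exact h3.symm
  have h0 : ((p : ℕ) : Module.End ℤ B) = 0 := by
    refine LinearMap.ext fun b => ?_
    rw [Module.End.natCast_apply, nsmul_eq_mul, CharP.cast_eq_zero, zero_mul]
    rfl
  have h := hit p (p * n) r
  rw [hexp, PowerSeries.coeff_mk_pow_prime hp h0 _ (fun a b => wder_commute k a b),
    mul_comm, Polynomial.coeff_expand_mul hp.pos] at h
  exact h.symm

end WittIterate

section WittPolynomial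

open MvPolynomial

variable {p : ℕ} [Fact p.Prime] {e : ℕ}

theorem wittAlpha_eq_zero (i j l : Fin e →₀ ℕ) (h : (xyExp e i j).degree < l.degree) :
    wittAlpha p e i j l = 0 := by
  have h1 : ∀ m, (1 : ℕ∞) ≤ (wittHmod p m : MvPowerSeries (Fin 2 × ℕ) (ZMod p)).order := by
    intro m
    rw [MvPowerSeries.one_le_order_iff_constCoeff_eq_zero,
      ← MvPowerSeries.coeff_zero_eq_constantCoeff_apply, coeff_coe, ← constantCoeff_eq, wittHmod,
      constantCoeff_map, WittVector.constantCoeff_wittAdd, map_zero]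
  rw [wittAlpha, ← coeff_coe]
  refine MvPowerSeries.coeff_of_lt_order (lt_of_lt_of_le (Nat.cast_lt.2 h) ?_)
  have h2 : ((∏ m : Fin e, wittHmod p (m : ℕ) ^ l m : MvPolynomial (Fin 2 × ℕ) (ZMod p)) :
      MvPowerSeries (Fin 2 × ℕ) (ZMod p)) =
      ∏ m : Fin e, (wittHmod p (m : ℕ) : MvPowerSeries (Fin 2 × ℕ) (ZMod p)) ^ l m :=
    (map_prod (coeToMvPowerSeries.ringHom (σ := Fin 2 × ℕ) (R := ZMod p)) _ _).trans
      (Finset.prod_congr rfl fun m _ => map_pow _ _ _)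
  rw [h2]
  refine le_trans ?_ (MvPowerSeries.le_order_prod _ _)
  rw [Finsupp.degree_eq_sum, Nat.cast_sum]
  refine Finset.sum_le_sum fun m _ => le_trans ?_ (MvPowerSeries.le_order_pow _)
  rw [nsmul_eq_mul]
  exact le_mul_of_one_le_right zero_le (h1 m)

theorem wittAlpha_finite (i j : Fin e →₀ ℕ) :
    {l : Fin e →₀ ℕ | wittAlpha p e i j l ≠ 0}.Finite :=
  (Finsupp.finite_of_degree_le (xyExp e i j).degree).subset fun l hl =>
    not_lt.1 fun h => hl (wittAlpha_eq_zero i j l h)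

variable (p) in
/-- The multi-indices with nonzero structure constant. -/
def wittSupport (i j : Fin e →₀ ℕ) : Finset (Fin e →₀ ℕ) := (wittAlpha_finite (p := p) i j).toFinset

theorem notMem_wittSupport {i j l : Fin e →₀ ℕ} (h : l ∉ wittSupport p i j) :
    wittAlpha p e i j l = 0 := by
  simpa [wittSupport] using h

theorem sum_support_eq_sum_wittSupport {R : Type*} [Ring R] (i j : Fin e →₀ ℕ)
    (s : Finset (Fin e →₀ ℕ)) (f : (Fin e →₀ ℕ) → R) (hf : ∀ l, l ∉ s → f l = 0) :
    ∑ l ∈ s, ZMod.cast (wittAlpha p e i j l) * f l =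
      ∑ l ∈ wittSupport p i j, ZMod.cast (wittAlpha p e i j l) * f l := by
  classical
  rw [Finset.sum_subset (Finset.subset_union_left (s₁ := s) (s₂ := wittSupport p i j)),
    Finset.sum_subset (Finset.subset_union_right (s₁ := s) (s₂ := wittSupport p i j))]
  · intro l _ hl
    rw [notMem_wittSupport hl, ZMod.cast_zero, zero_mul]
  · intro l _ hl
    rw [hf l hl, mul_zero]

theorem finsum_wittAlpha {R : Type*} [Ring R] (i j : Fin e →₀ ℕ) (f : (Fin e → ℕ) → R) :
    ∑ᶠ l : Fin e → ℕ, ZMod.cast (wittAlpha p e i j l) * f l =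
      ∑ l ∈ wittSupport p i j, ZMod.cast (wittAlpha p e i j l) * f l := by
  rw [← finsum_comp_equiv (Finsupp.equivFunOnFinite : (Fin e →₀ ℕ) ≃ (Fin e → ℕ))]
  refine finsum_eq_sum_of_support_subset _ fun l hl => ?_
  by_contra h
  refine hl ?_
  change (wittAlpha p e i j l).cast * f l = 0
  rw [notMem_wittSupport (p := p) h, ZMod.cast_zero, zero_mul]

variable {K : Type*} [CommRing K] [CharP K p]

theorem wop_wop' (i j : Fin e →₀ ℕ) (r : MvPolynomial (Fin e) K) :
    wop p i (wop p j r) =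
      ∑ l ∈ wittSupport p i j, ZMod.cast (wittAlpha p e i j l) * wop p l r := by
  rw [wop_wop, sum_support_eq_sum_wittSupport]
  exact fun l hl => notMem_support_iff.1 hl

theorem coeff_wop (i j : Fin e →₀ ℕ) (r : MvPolynomial (Fin e) K) :
    coeff i (wop p j r) =
      ∑ l ∈ wittSupport p i j, ZMod.cast (wittAlpha p e i j l) * coeff l r := by
  rw [← sum_support_eq_sum_wittSupport _ _ r.support _ fun l hl => notMem_support_iff.1 hl]
  have h : wtrans p e K r =
      ∑ l ∈ r.support, C (C (coeff l r)) * ∏ m : Fin e, (wsum p e K).coeff m ^ l m := by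
    change aeval _ r = _
    rw [aeval_def, eval₂_eq']
    rfl
  rw [wop, h, coeff_sum, coeff_sum]
  refine Finset.sum_congr rfl fun l _ => ?_
  rw [coeff_C_mul, coeff_C_mul, coeff_prod_wsum, mul_comm]

theorem wop_mul (j : Fin e →₀ ℕ) (f g : MvPolynomial (Fin e) K) :
    wop p j (f * g) = ∑ x ∈ antidiagonal j, wop p x.1 f * wop p x.2 g := by
  classical
  rw [wop, map_mul, coeff_mul]
  exact Finset.sum_congr (by ext; simp) fun _ _ => rfl

variable (p) in
/-- The basic operators on polynomials. -/
def wD (he : 1 ≤ e) (n : ℕ) : MvPolynomial (Fin e) K → MvPolynomial (Fin e) K :=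
  wop p (Finsupp.single ⟨0, he⟩ n)

theorem wD_iterate (he : 1 ≤ e) (n k : ℕ) (r : MvPolynomial (Fin e) K) :
    (wD p he n)^[p ^ k] r = wder p e K k n r := by
  induction k generalizing r with
  | zero =>
    rw [pow_zero, Function.iterate_one, wder_apply]
    exact (coeff_wflow (p := p) (K := K) ⟨0, he⟩ n r).symm
  | succ k ih =>
    rw [pow_succ, Function.iterate_mul, ← wder_pow, Module.End.pow_apply]
    congr 1
    exact funext ih

theorem wD_iterate_eq_zero (he : 1 ≤ e) (n : ℕ) (hn : 1 ≤ n) (r : MvPolynomial (Fin e) K) :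
    (wD p he n)^[p ^ e] r = 0 := by
  rw [wD_iterate, wder_apply, wflow_of_le le_rfl, Polynomial.coeff_C, if_neg (by omega)]

theorem wD_iterate_fin (he : 1 ≤ e) (n : ℕ) (k : Fin e) (r : MvPolynomial (Fin e) K) :
    (wD p he n)^[p ^ (k : ℕ)] r = wop p (Finsupp.single k n) r := by
  rw [wD_iterate, wder_apply, coeff_wflow]

theorem hsComp_wD (he : 1 ≤ e) (v : Fin e →₀ ℕ) (r : MvPolynomial (Fin e) K) :
    hsComp p e (wD p he) v r = wop p v r := by
  have key : ∀ l : List (Fin e), l.Pairwise (· < ·) →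
      (∀ m, m ∉ l → (l.map fun k => Finsupp.single k (v k)).sum m = 0) ∧
      (l.map fun k : Fin e => (wD p he (v k))^[p ^ (k : ℕ)]).foldr (· ∘ ·) id r =
        wop p (l.map fun k => Finsupp.single k (v k)).sum r := by
    intro l hl
    induction l with
    | nil => exact ⟨fun _ _ => rfl, (wop_zero r).symm⟩
    | cons a l ih =>
      obtain ⟨h1, h2⟩ := ih hl.of_cons
      refine ⟨fun m hm => ?_, ?_⟩
      · rw [List.mem_cons, not_or] at hm
        rw [List.map_cons, List.sum_cons, Finsupp.add_apply, h1 m hm.2,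
          Finsupp.single_eq_of_ne hm.1]
      · rw [List.map_cons, List.foldr_cons, Function.comp_apply, h2, wD_iterate_fin,
          wop_wop_of_separated a, List.map_cons, List.sum_cons]
        · intro m hm
          exact Finsupp.single_eq_of_ne (fun h => by subst h; exact lt_irrefl _ hm)
        · intro m hm
          refine h1 m fun hml => ?_
          exact absurd (List.rel_of_pairwise_cons hl hml) (not_lt.2 hm)
  have h := (key (List.finRange e) (List.pairwise_lt_finRange e)).2
  rw [← List.ofFn_eq_map, ← List.ofFn_eq_map, List.sum_ofFn, Finsupp.univ_sum_single] at h
  exact h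

theorem coeff_add_wsingle {S : Type*} [CommRing S] (k : ℕ) (x : WittVector p S) (t : S) :
    (x + wsingle p k t).coeff k = x.coeff k + t := by
  have hV : ∀ a : S, wsingle p k a = (WittVector.verschiebung)^[k] (wsingle p 0 a) := by
    intro a
    ext m : 1
    by_cases hm : m < k
    · rw [WittVector.iterate_verschiebung_coeff_eq_zero _ hm, wsingle_coeff, if_neg (by omega)]
    · obtain ⟨m, rfl⟩ := Nat.exists_eq_add_of_le (not_lt.1 hm)
      rw [add_comm, WittVector.iterate_verschiebung_coeff, wsingle_coeff, wsingle_coeff]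
      simp
  have hVadd : ∀ (n : ℕ) (a b : WittVector p S), (WittVector.verschiebung)^[n] (a + b) =
      (WittVector.verschiebung)^[n] a + (WittVector.verschiebung)^[n] b := fun n =>
    iterate_map_add _ n
  have h1 : ∀ a b : S, WittVector.truncate (k + 1) (wsingle p k a + wsingle p k b) =
      WittVector.truncate (k + 1) (wsingle p k (a + b)) := by
    intro a b
    refine truncate_eq_of fun m hm => ?_
    rw [hV, hV, ← hVadd]
    by_cases hmk : m < k
    · rw [WittVector.iterate_verschiebung_coeff_eq_zero _ hmk, wsingle_coeff, if_neg (by omega)]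
    · obtain rfl : m = k := by omega
      have := WittVector.iterate_verschiebung_coeff (wsingle p 0 a + wsingle p 0 b) m 0
      rw [zero_add] at this
      rw [this, WittVector.add_coeff_zero]
      simp [wsingle_coeff]
  let y : WittVector p S := WittVector.mk p fun m => if m < k then x.coeff m else 0
  have hy : ∀ m, y.coeff m = if m < k then x.coeff m else 0 := fun m => rfl
  have hdis : ∀ a m, (y + wsingle p k a).coeff m = y.coeff m + (wsingle p k a).coeff m := by
    intro a m
    refine WittVector.coeff_add_of_disjoint _ _ _ fun n => ?_
    rw [hy, wsingle_coeff]
    by_cases h : n = k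
    · left; rw [if_neg (by omega)]
    · right; rw [if_neg h]
  have h2 : WittVector.truncate (k + 1) x = WittVector.truncate (k + 1) (y + wsingle p k (x.coeff k)) := by
    refine truncate_eq_of fun m hm => ?_
    rw [hdis, hy, wsingle_coeff]
    by_cases hmk : m < k
    · rw [if_pos hmk, if_neg (by omega), add_zero]
    · obtain rfl : m = k := by omega
      simp
  have h3 : WittVector.truncate (k + 1) (x + wsingle p k t) =
      WittVector.truncate (k + 1) (y + wsingle p k (x.coeff k + t)) := by
    rw [map_add, h2, ← map_add, add_assoc, map_add, h1, ← map_add]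
  have h4 := congrArg (TruncatedWittVector.coeff (⟨k, Nat.lt_succ_self k⟩ : Fin (k + 1))) h3
  rw [WittVector.coeff_truncate, WittVector.coeff_truncate] at h4
  rw [h4, hdis, hy, wsingle_coeff]
  simp

theorem coeff_add_wsingle_of_lt {S : Type*} [CommRing S] {k m : ℕ} (h : m < k)
    (x : WittVector p S) (t : S) : (x + wsingle p k t).coeff m = x.coeff m := by
  have h0 : WittVector.truncate (m + 1) (wsingle p k t) = 0 := by
    rw [← map_zero (WittVector.truncate (m + 1))]
    refine truncate_eq_of fun n hn => ?_
    rw [wsingle_coeff, if_neg (by omega), WittVector.zero_coeff]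
  have h3 : WittVector.truncate (m + 1) (x + wsingle p k t) = WittVector.truncate (m + 1) x := by
    rw [map_add, h0, add_zero]
  have h4 := congrArg (TruncatedWittVector.coeff (⟨m, Nat.lt_succ_self m⟩ : Fin (m + 1))) h3
  rwa [WittVector.coeff_truncate, WittVector.coeff_truncate] at h4

variable (p e K) in
/-- The first-order part of translation along the `k`-th component, as a derivation. -/
def wderivation (k : Fin e) : Derivation ℤ (MvPolynomial (Fin e) K) (MvPolynomial (Fin e) K) :=
  Derivation.mk' (wder p e K k 1) fun a b => by
    have h0 : ∀ r, (wflow p e K k r).coeff 0 = r := fun r => by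
      rw [coeff_wflow, Finsupp.single_zero, wop_zero]
    rw [wder_apply, map_mul, Polynomial.mul_coeff_one, h0, h0, smul_eq_mul, smul_eq_mul,
      wder_apply, wder_apply, mul_comm b]

theorem wderivation_apply (k : Fin e) (r : MvPolynomial (Fin e) K) :
    wderivation p e K k r = wder p e K k 1 r := rfl

theorem wderivation_X_self (k : Fin e) : wderivation p e K k (X k) = 1 := by
  rw [wderivation_apply, wder_apply, wflow_X, coeff_add_wsingle, WittVector.map_coeff,
    Polynomial.coeff_add, Polynomial.coeff_C, Polynomial.coeff_X_one]
  simp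

theorem wderivation_X_of_lt {k m : Fin e} (h : m < k) : wderivation p e K k (X m) = 0 := by
  rw [wderivation_apply, wder_apply, wflow_X, coeff_add_wsingle_of_lt h, WittVector.map_coeff,
    Polynomial.coeff_C]
  simp

theorem Derivation.iterate_mul_pow {R A : Type*} [CommRing R] [CommRing A] [Algebra R A]
    (D : Derivation R A A) (x c : A) (hx : D x = 1) (hc : D c = 0) (m : ℕ) :
    D^[m] (c * x ^ m) = m.factorial * c := by
  induction m generalizing c with
  | zero => simp
  | succ m ih =>
    rw [Function.iterate_succ_apply, Derivation.leibniz, Derivation.leibniz_pow, hx, hc,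
      smul_zero, add_zero, Nat.add_sub_cancel]
    have : c • (m + 1) • x ^ m • (1 : A) = ((m + 1 : ℕ) * c) * x ^ m := by
      rw [smul_eq_mul, nsmul_eq_mul, smul_eq_mul]; ring
    rw [this, ih, Nat.factorial_succ]
    · push_cast; ring
    · rw [← nsmul_eq_mul, map_nsmul, hc, smul_zero]

theorem wD_iterate_prod (he : 1 ≤ e) (k : ℕ) (hk : k ≤ e) :
    (wD p he 1)^[p ^ k - 1] (∏ m ∈ Finset.univ.filter (fun m : Fin e => (m : ℕ) < k), X m ^ (p - 1)) =
      (((p - 1).factorial ^ k : ℕ) : MvPolynomial (Fin e) K) := by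
  have hp : p.Prime := Fact.out
  induction k with
  | zero => simp
  | succ k ih =>
    have hk' : k < e := hk
    have h1 : Finset.univ.filter (fun m : Fin e => (m : ℕ) < k + 1) =
        insert ⟨k, hk'⟩ (Finset.univ.filter (fun m : Fin e => (m : ℕ) < k)) := by
      ext m
      simp only [Finset.mem_filter, Finset.mem_univ, true_and, Finset.mem_insert, Fin.ext_iff]
      omega
    have h2 : p ^ (k + 1) - 1 = (p ^ k - 1) + p ^ k * (p - 1) := by
      have : 1 ≤ p ^ k := Nat.one_le_pow _ _ hp.pos
      have h3 : p ^ k * (p - 1) = p ^ k * p - p ^ k := by rw [Nat.mul_sub, mul_one]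
      have : p ^ k * 1 ≤ p ^ k * p := Nat.mul_le_mul_left _ hp.one_le
      rw [h3, pow_succ]
      omega
    have h3 : (wD p he 1)^[p ^ k] = wderivation p e K ⟨k, hk'⟩ := funext fun r =>
      wD_iterate he 1 k r
    have h4 : ∀ n, (wD p he 1)^[n] (((p - 1).factorial : MvPolynomial (Fin e) K) *
        ∏ m ∈ Finset.univ.filter (fun m : Fin e => (m : ℕ) < k), X m ^ (p - 1)) = ((p - 1).factorial : MvPolynomial (Fin e) K) *
        (wD p he 1)^[n] (∏ m ∈ Finset.univ.filter (fun m : Fin e => (m : ℕ) < k), X m ^ (p - 1)) := by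
      intro n
      let f : Module.End ℤ (MvPolynomial (Fin e) K) := wder p e K 0 1
      have hf : (wD p he 1) = f := funext fun r => by
        have := wD_iterate he 1 0 r
        rwa [pow_zero, Function.iterate_one] at this
      rw [hf, ← Module.End.pow_apply, ← Module.End.pow_apply, ← nsmul_eq_mul, map_nsmul,
        nsmul_eq_mul]
    rw [h1, Finset.prod_insert (by simp), mul_comm, h2, Function.iterate_add_apply,
      Function.iterate_mul, h3, Derivation.iterate_mul_pow _ _ _ (wderivation_X_self _), h4,
      ih (by omega), pow_succ]
    · push_cast; ring
    · refine Finset.prod_induction _ (fun r => wderivation p e K ⟨k, hk'⟩ r = 0) ?_ ?_ ?_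
      · intro a b ha hb
        rw [Derivation.leibniz, ha, hb, smul_zero, smul_zero, add_zero]
      · exact Derivation.map_one_eq_zero _
      · intro m hm
        rw [Derivation.leibniz_pow, wderivation_X_of_lt, smul_zero, smul_zero]
        exact (Finset.mem_filter.1 hm).2

end WittPolynomial

instance MvPowerSeries.instCharP {σ R : Type*} [CommRing R] (p : ℕ) [CharP R p] :
    CharP (MvPowerSeries σ R) p :=
  charP_of_injective_ringHom (MvPowerSeries.C_injective (σ := σ) (R := R)) p

/-- The equational part of the axioms. -/
structure IsWittHS (p : ℕ) [Fact p.Prime] (e : ℕ) {R : Type*} [CommRing R] (D : ℕ → R → R) :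
    Prop extends IsHS D where
  comm : ∀ i j x, D i (D j x) = D j (D i x)
  nil : ∀ n, 1 ≤ n → ∀ x, (D n)^[p ^ e] x = 0
  witt : ∀ (i j : Fin e →₀ ℕ) x, hsComp p e D i (hsComp p e D j x) =
    ∑ l ∈ wittSupport p i j, ZMod.cast (wittAlpha p e i j l) * hsComp p e D l x

section WittPowerSeries

variable {p : ℕ} [Fact p.Prime] {e : ℕ} {K : Type*} [CommRing K]

variable (p) in
/-- The operators of the regular action of the Witt group on power series. -/
def pop (j : Fin e →₀ ℕ) (f : MvPowerSeries (Fin e) K) : MvPowerSeries (Fin e) K :=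
  fun i => ∑ l ∈ wittSupport p i j, ZMod.cast (wittAlpha p e i j l) * MvPowerSeries.coeff l f

theorem coeff_pop (i j : Fin e →₀ ℕ) (f : MvPowerSeries (Fin e) K) :
    MvPowerSeries.coeff i (pop p j f) =
      ∑ l ∈ wittSupport p i j, ZMod.cast (wittAlpha p e i j l) * MvPowerSeries.coeff l f := rfl

variable (p) in
/-- The basic operators on power series. -/
def pD (he : 1 ≤ e) (n : ℕ) : MvPowerSeries (Fin e) K → MvPowerSeries (Fin e) K :=
  pop p (Finsupp.single ⟨0, he⟩ n)

theorem pop_add (j : Fin e →₀ ℕ) (f g : MvPowerSeries (Fin e) K) :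
    pop p j (f + g) = pop p j f + pop p j g := by
  ext i
  simp only [map_add, coeff_pop, mul_add, Finset.sum_add_distrib]

variable [CharP K p]

theorem pop_coe (j : Fin e →₀ ℕ) (r : MvPolynomial (Fin e) K) :
    pop p j (r : MvPowerSeries (Fin e) K) = (wop p j r : MvPowerSeries (Fin e) K) := by
  ext i
  rw [coeff_pop, MvPolynomial.coeff_coe, coeff_wop]
  rfl

theorem pD_coe (he : 1 ≤ e) (n : ℕ) (r : MvPolynomial (Fin e) K) :
    pD p he n (r : MvPowerSeries (Fin e) K) = (wD p he n r : MvPowerSeries (Fin e) K) :=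
  pop_coe _ r

theorem pD_iterate_coe (he : 1 ≤ e) (n m : ℕ) (r : MvPolynomial (Fin e) K) :
    (pD p he n)^[m] (r : MvPowerSeries (Fin e) K) =
      ((wD p he n)^[m] r : MvPolynomial (Fin e) K) := by
  induction m with
  | zero => rfl
  | succ m ih => rw [Function.iterate_succ_apply', ih, pD_coe, Function.iterate_succ_apply']

theorem foldr_comp_of_semiconj {ι A B : Type*} (c : A → B) (f : ι → A → A) (g : ι → B → B)
    (h : ∀ i a, g i (c a) = c (f i a)) (l : List ι) (a : A) :
    (l.map g).foldr (· ∘ ·) id (c a) = c ((l.map f).foldr (· ∘ ·) id a) := by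
  induction l with
  | nil => rfl
  | cons i l ih =>
    simp only [List.map_cons, List.foldr_cons, Function.comp_apply, ih, h]

theorem hsComp_of_semiconj {A B : Type*} (c : A → B) {D : ℕ → A → A} {D' : ℕ → B → B}
    (h : ∀ n a, D' n (c a) = c (D n a)) (p e : ℕ) (v : Fin e → ℕ) (a : A) :
    hsComp p e D' v (c a) = c (hsComp p e D v a) := by
  rw [hsComp, hsComp, List.ofFn_eq_map, List.ofFn_eq_map]
  refine foldr_comp_of_semiconj c (fun m : Fin e => (D (v m))^[p ^ (m : ℕ)]) _ (fun m x => ?_) _ a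
  exact (Function.Semiconj.iterate_right (f := c) (fun x => (h _ x).symm) (p ^ (m : ℕ)) x).symm

section Topology

open scoped MvPowerSeries.WithPiTopology

variable [TopologicalSpace K] [DiscreteTopology K]

theorem continuous_pop (j : Fin e →₀ ℕ) :
    Continuous (pop p j : MvPowerSeries (Fin e) K → MvPowerSeries (Fin e) K) := by
  refine continuous_pi fun i => continuous_finsetSum _ fun l _ => ?_
  exact (continuous_of_discreteTopology (f := fun x : K =>
    ZMod.cast (wittAlpha p e i j l) * x)).comp (MvPowerSeries.WithPiTopology.continuous_coeff K l)

theorem continuous_pD_iterate (he : 1 ≤ e) (n m : ℕ) :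
    Continuous ((pD p he n)^[m] : MvPowerSeries (Fin e) K → MvPowerSeries (Fin e) K) :=
  (continuous_pop _).iterate m

theorem continuous_hsComp {T : Type*} [TopologicalSpace T] {D : ℕ → T → T}
    (h : ∀ n, Continuous (D n)) (v : Fin e → ℕ) : Continuous (hsComp p e D v) := by
  rw [hsComp, List.ofFn_eq_map]
  generalize List.finRange e = l
  induction l with
  | nil => exact continuous_id
  | cons a l ih => exact ((h _).iterate _).comp ih

theorem eq_of_continuous_of_coe {F G : MvPowerSeries (Fin e) K → MvPowerSeries (Fin e) K}
    (hF : Continuous F) (hG : Continuous G)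
    (h : ∀ r : MvPolynomial (Fin e) K, F r = G r) (f : MvPowerSeries (Fin e) K) : F f = G f :=
  congrFun (MvPowerSeries.WithPiTopology.denseRange_toMvPowerSeries.equalizer hF hG (funext h)) f

end Topology

theorem pop_mul (j : Fin e →₀ ℕ) (f g : MvPowerSeries (Fin e) K) :
    pop p j (f * g) = ∑ x ∈ antidiagonal j, pop p x.1 f * pop p x.2 g := by
  let _ : TopologicalSpace K := ⊥
  have : DiscreteTopology K := ⟨rfl⟩
  open scoped MvPowerSeries.WithPiTopology in
  refine eq_of_continuous_of_coe (F := fun f => pop p j (f * g))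
    (G := fun f => ∑ x ∈ antidiagonal j, pop p x.1 f * pop p x.2 g)
    ((continuous_pop j).comp (continuous_mul_const g))
    (continuous_finsetSum _ fun x _ => (continuous_pop _).mul continuous_const) (fun r => ?_) f
  open scoped MvPowerSeries.WithPiTopology in
  refine eq_of_continuous_of_coe (F := fun g => pop p j ((r : MvPowerSeries (Fin e) K) * g))
    (G := fun g => ∑ x ∈ antidiagonal j, pop p x.1 (r : MvPowerSeries (Fin e) K) * pop p x.2 g)
    ((continuous_pop j).comp (continuous_const_mul _))
    (continuous_finsetSum _ fun x _ => continuous_const.mul (continuous_pop _)) (fun s => ?_) g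
  rw [← MvPolynomial.coe_mul, pop_coe, wop_mul]
  simp only [pop_coe, ← MvPolynomial.coe_mul]
  exact map_sum (MvPolynomial.coeToMvPowerSeries.ringHom (σ := Fin e) (R := K)) _ _

theorem hsComp_pD (he : 1 ≤ e) (v : Fin e →₀ ℕ) (f : MvPowerSeries (Fin e) K) :
    hsComp p e (pD p he) v f = pop p v f := by
  let _ : TopologicalSpace K := ⊥
  have : DiscreteTopology K := ⟨rfl⟩
  open scoped MvPowerSeries.WithPiTopology in
  refine eq_of_continuous_of_coe (F := hsComp p e (pD p he) v)
    (continuous_hsComp (fun n => continuous_pop _) _)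
    (continuous_pop v) (fun r => ?_) f
  rw [hsComp_of_semiconj (fun r : MvPolynomial (Fin e) K => (r : MvPowerSeries (Fin e) K))
    (fun n a => pD_coe he n a), pop_coe, hsComp_wD]

theorem isWittHS_pD (he : 1 ≤ e) :
    IsWittHS p e (pD p he : ℕ → MvPowerSeries (Fin e) K → MvPowerSeries (Fin e) K) := by
  let _ : TopologicalSpace K := ⊥
  have : DiscreteTopology K := ⟨rfl⟩
  open scoped MvPowerSeries.WithPiTopology in
  exact
  { zero := eq_of_continuous_of_coe (continuous_pop _) continuous_id fun r => by
      rw [pD_coe, wD, Finsupp.single_zero, wop_zero]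
    add := fun n => pop_add _
    mul := fun n f g => by
      rw [pD, pop_mul, Finsupp.antidiagonal_single, Finset.sum_map]
      rfl
    comm := fun i j => eq_of_continuous_of_coe ((continuous_pop _).comp (continuous_pop _))
      ((continuous_pop _).comp (continuous_pop _)) fun r => by
        simp only [pD_coe]
        exact congrArg _ (wop_comm _ _ r)
    nil := fun n hn => eq_of_continuous_of_coe (continuous_pD_iterate he n _) continuous_const
      fun r => by rw [pD_iterate_coe, wD_iterate_eq_zero he n hn]; rfl
    witt := fun i j f => by
      simp only [hsComp_pD]
      refine eq_of_continuous_of_coe ((continuous_pop _).comp (continuous_pop _))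
        (continuous_finsetSum _ fun l _ => continuous_const.mul (continuous_pop _))
        (fun r => ?_) f
      simp only [Function.comp_apply, pop_coe, wop_wop']
      refine (map_sum (MvPolynomial.coeToMvPowerSeries.ringHom (σ := Fin e) (R := K)) _ _).trans
        (Finset.sum_congr rfl fun l _ => ?_)
      rw [map_mul, Pi.mul_apply, pop_coe]
      congr 1
      exact DFunLike.congr_fun (Subsingleton.elim ((MvPolynomial.coeToMvPowerSeries.ringHom
        (σ := Fin e) (R := K)).comp (ZMod.castHom (dvd_refl p) _)) (ZMod.castHom (dvd_refl p) _)) _ }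

theorem exists_pD_iterate_ne_zero [Nontrivial K] (he : 1 ≤ e) :
    ∃ f : MvPowerSeries (Fin e) K, (pD p he 1)^[p ^ e - 1] f ≠ 0 := by
  refine ⟨((∏ m ∈ Finset.univ.filter (fun m : Fin e => (m : ℕ) < e), MvPolynomial.X m ^ (p - 1) :
    MvPolynomial (Fin e) K) : MvPowerSeries (Fin e) K), ?_⟩
  rw [pD_iterate_coe, wD_iterate_prod he e le_rfl]
  intro h
  rw [← MvPolynomial.coe_zero] at h
  have h1 := MvPolynomial.coe_injective (Fin e) K h
  rw [CharP.cast_eq_zero_iff _ p] at h1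
  have hp : p.Prime := Fact.out
  have := (hp.dvd_factorial).1 (hp.dvd_of_dvd_pow h1)
  have := hp.pos
  omega

end WittPowerSeries

theorem RingHom.map_zmodCast {p : ℕ} {R S : Type*} [CommRing R] [CommRing S] [CharP R p]
    [CharP S p] (f : R →+* S) (a : ZMod p) : f (ZMod.cast a) = ZMod.cast a :=
  DFunLike.congr_fun (Subsingleton.elim (f.comp (ZMod.castHom (dvd_refl p) R))
    (ZMod.castHom (dvd_refl p) S)) a

section Etale

/-- Ring homomorphisms on a formally smooth algebra lift along complete ideals. -/
theorem exists_ringHom_lift_of_formallySmooth {A P S : Type*} [CommRing A] [CommRing P]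
    [CommRing S] [Algebra A P] [Algebra.FormallySmooth A P] (I : Ideal S) [IsAdicComplete I S]
    (g : A →+* S) (q : P →+* S ⧸ I)
    (h : q.comp (algebraMap A P) = (Ideal.Quotient.mk I).comp g) :
    ∃ φ : P →+* S, φ.comp (algebraMap A P) = g ∧ (Ideal.Quotient.mk I).comp φ = q := by
  let : Algebra A S := g.toAlgebra
  let f : P →ₐ[A] S ⧸ I := { q with commutes' := fun a => DFunLike.congr_fun h a }
  obtain ⟨φ, hφ⟩ := Algebra.FormallySmooth.exists_mkₐ_comp_eq_of_isAdicComplete f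
  refine ⟨φ, RingHom.ext fun a => φ.commutes a, RingHom.ext fun x => DFunLike.congr_fun hφ x⟩

theorem exists_powerSeries_lift {A P : Type*} [CommRing A] [CommRing P] [Algebra A P]
    [Algebra.FormallySmooth A P] (g : A →+* PowerSeries P)
    (hg : ∀ a, PowerSeries.constantCoeff (g a) = algebraMap A P a) :
    ∃ φ : P →+* PowerSeries P, φ.comp (algebraMap A P) = g ∧
      ∀ x, PowerSeries.constantCoeff (φ x) = x := by
  have hker : ∀ f : PowerSeries P, PowerSeries.constantCoeff f = 0 ↔
      f ∈ Ideal.span {(PowerSeries.X : PowerSeries P)} := fun f => by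
    rw [Ideal.mem_span_singleton, PowerSeries.X_dvd_iff]
  obtain ⟨φ, h1, h2⟩ := exists_ringHom_lift_of_formallySmooth
    (Ideal.span {(PowerSeries.X : PowerSeries P)}) g
    ((Ideal.Quotient.mk _).comp (PowerSeries.C (R := P))) (by
      ext a
      refine (Ideal.Quotient.mk_eq_mk_iff_sub_mem _ _).2 ((hker _).1 ?_)
      rw [map_sub, hg, PowerSeries.constantCoeff_C]
      exact sub_self _)
  refine ⟨φ, h1, fun x => ?_⟩
  have h3 := (hker _).2 ((Ideal.Quotient.mk_eq_mk_iff_sub_mem _ _).1 (DFunLike.congr_fun h2 x))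
  rwa [map_sub, PowerSeries.constantCoeff_C, sub_eq_zero] at h3

/-- Ring homomorphisms on a separable extension of a fraction field are determined by their
restriction and their reduction along a local homomorphism. -/
theorem ringHom_ext_of_isSeparable {A F P Q T : Type*} [CommRing A] [Field F] [Field P]
    [CommRing Q] [CommRing T] [Nontrivial T] [Algebra A F] [Algebra F P] [Algebra A P]
    [IsScalarTower A F P] (hAF : IsFractionRing A F) [Algebra.IsSeparable F P]
    (ρ : Q →+* T) [IsLocalHom ρ] (φ ψ : P →+* Q) (h : ρ.comp φ = ρ.comp ψ)
    (hA : φ.comp (algebraMap A P) = ψ.comp (algebraMap A P)) : φ = ψ := by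
  have hF : φ.comp (algebraMap F P) = ψ.comp (algebraMap F P) := by
    refine IsLocalization.ringHom_ext (nonZeroDivisors A) ?_
    rw [RingHom.comp_assoc, RingHom.comp_assoc, ← IsScalarTower.algebraMap_eq, hA]
  ext x
  let f := minpoly F x
  let g : Polynomial Q := f.map (φ.comp (algebraMap F P))
  have hfx : Polynomial.aeval x f = 0 := minpoly.aeval F x
  have h1 : g.eval (φ x) = 0 := by
    rw [Polynomial.eval_map, ← Polynomial.hom_eval₂, ← Polynomial.aeval_def, hfx, map_zero]
  have hg : g = f.map (ψ.comp (algebraMap F P)) := by rw [← hF]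
  have h2 : g.eval (ψ x) = 0 := by
    rw [hg, Polynomial.eval_map, ← Polynomial.hom_eval₂, ← Polynomial.aeval_def, hfx, map_zero]
  obtain ⟨k, hk⟩ := Polynomial.binomExpansion g (ψ x) (φ x - ψ x)
  rw [add_sub_cancel, h1, h2, zero_add] at hk
  have hd : g.derivative.eval (ψ x) = ψ (Polynomial.aeval x f.derivative) := by
    rw [hg, Polynomial.derivative_map, Polynomial.eval_map, ← Polynomial.hom_eval₂,
      ← Polynomial.aeval_def]
  have hne : Polynomial.aeval x f.derivative ≠ 0 :=
    (Algebra.IsSeparable.isSeparable F x).aeval_derivative_ne_zero hfx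
  have hρ : ρ (φ x - ψ x) = 0 := by
    rw [map_sub, sub_eq_zero]
    exact DFunLike.congr_fun h x
  have hu : IsUnit (g.derivative.eval (ψ x) + k * (φ x - ψ x)) := by
    refine isUnit_of_map_unit ρ _ ?_
    rw [map_add, map_mul, hρ, mul_zero, add_zero, hd]
    exact ((Ne.isUnit hne).map ψ).map ρ
  have h3 : (g.derivative.eval (ψ x) + k * (φ x - ψ x)) * (φ x - ψ x) = 0 := by
    rw [hk]; ring
  exact sub_eq_zero.1 (hu.mul_right_eq_zero.1 h3)

instance isLocalHom_powerSeries_constantCoeff {R : Type*} [CommRing R] :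
    IsLocalHom (PowerSeries.constantCoeff (R := R)) :=
  ⟨fun _ h => PowerSeries.isUnit_iff_constantCoeff.2 h⟩

instance isLocalHom_mvPowerSeries_constantCoeff {σ R : Type*} [CommRing R] :
    IsLocalHom (MvPowerSeries.constantCoeff (σ := σ) (R := R)) :=
  ⟨fun _ h => MvPowerSeries.isUnit_iff_constantCoeff.2 h⟩

/-- Exchanging the two variables of iterated power series. -/
def PowerSeries.swap (R : Type*) [CommRing R] :
    PowerSeries (PowerSeries R) →+* PowerSeries (PowerSeries R) where
  toFun f := PowerSeries.mk fun i => PowerSeries.mk fun j =>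
    PowerSeries.coeff i (PowerSeries.coeff j f)
  map_one' := by
    ext i j
    simp only [PowerSeries.coeff_mk, PowerSeries.coeff_one]
    split_ifs <;> simp_all [PowerSeries.coeff_one]
  map_zero' := by ext; simp
  map_add' f g := by ext; simp
  map_mul' f g := by
    ext i j
    simp only [PowerSeries.coeff_mk, PowerSeries.coeff_mul, map_sum]
    exact Finset.sum_comm

theorem PowerSeries.coeff_coeff_swap {R : Type*} [CommRing R] (f : PowerSeries (PowerSeries R))
    (i j : ℕ) : PowerSeries.coeff j (PowerSeries.coeff i (PowerSeries.swap R f)) =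
      PowerSeries.coeff i (PowerSeries.coeff j f) := by
  simp [PowerSeries.swap]

variable {p : ℕ} [Fact p.Prime] {e : ℕ}

theorem pop_zero {K : Type*} [CommRing K] [CharP K p] (he : 1 ≤ e) (f : MvPowerSeries (Fin e) K) :
    pop p 0 f = f := by
  have := (isWittHS_pD (p := p) (K := K) he).zero f
  rwa [pD, Finsupp.single_zero] at this

variable (p) in
/-- Translation of power series, expanded in the translation parameter. -/
def ptransFun {K : Type*} [CommRing K] [CharP K p] (f : MvPowerSeries (Fin e) K) :
    MvPowerSeries (Fin e) (MvPowerSeries (Fin e) K) :=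
  fun j => pop p j f

theorem coeff_ptransFun {K : Type*} [CommRing K] [CharP K p] (f : MvPowerSeries (Fin e) K)
    (j : Fin e →₀ ℕ) : MvPowerSeries.coeff j (ptransFun p f) = pop p j f := rfl

variable (p) in
/-- Translation of power series, as a ring homomorphism. -/
def ptrans (he : 1 ≤ e) (K : Type*) [CommRing K] [CharP K p] :
    MvPowerSeries (Fin e) K →+* MvPowerSeries (Fin e) (MvPowerSeries (Fin e) K) where
  toFun := ptransFun p
  map_zero' := MvPowerSeries.ext fun j => by
    have := pop_add (p := p) j (0 : MvPowerSeries (Fin e) K) 0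
    rwa [add_zero, left_eq_add] at this
  map_add' f g := MvPowerSeries.ext fun j => pop_add j f g
  map_mul' f g := by
    classical
    ext1 j
    refine Eq.trans ?_ (MvPowerSeries.coeff_mul j (ptransFun p f) (ptransFun p g)).symm
    rw [coeff_ptransFun]
    exact (pop_mul j f g).trans (Finset.sum_congr (by ext; simp) fun _ _ => rfl)
  map_one' := by
    classical
    ext1 j
    rw [coeff_ptransFun, MvPowerSeries.coeff_one, ← hsComp_pD he]
    split_ifs with h
    · subst h
      exact IsHS.hsComp_zero_of (isWittHS_pD (p := p) (K := K) he).zero _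
    · rw [IsHS.hsComp_eq_familyComp]
      exact IsHS.familyComp_one (fun m => (isWittHS_pD (p := p) (K := K) he).toIsHS.iterate_prime_pow
        (Fact.out : p.Prime) (isWittHS_pD he).comm m) _ fun h0 => h (DFunLike.coe_injective h0)

theorem coeff_ptrans {K : Type*} [CommRing K] [CharP K p] (he : 1 ≤ e)
    (f : MvPowerSeries (Fin e) K) (j : Fin e →₀ ℕ) :
    MvPowerSeries.coeff j (ptrans p he K f) = pop p j f := rfl

end Etale

section Extension

variable {p : ℕ} [Fact p.Prime] {e : ℕ}

/-- Witt-iterative Hasse–Schmidt derivations extend to separable algebraic extensions of the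
fraction field. -/
theorem IsWittHS.exists_extension (he : 1 ≤ e) {A F P : Type*} [CommRing A] [Field F] [Field P]
    [CharP A p] [CharP P p] [Algebra A F] [Algebra F P] [Algebra A P] [IsScalarTower A F P]
    (hAF : IsFractionRing A F) [Algebra.IsSeparable F P] {D : ℕ → A → A} (hD : IsWittHS p e D) :
    ∃ D' : ℕ → P → P, IsWittHS p e D' ∧
      ∀ n a, D' n (algebraMap A P a) = algebraMap A P (D n a) := by
  have hp : p.Prime := Fact.out
  have : Algebra.FormallyEtale A F := Algebra.FormallyEtale.of_isLocalization (nonZeroDivisors A)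
  have : Algebra.FormallyEtale F P := Algebra.FormallyEtale.of_isSeparable F P
  have : Algebra.FormallyEtale A P := Algebra.FormallyEtale.comp A F P
  obtain ⟨φ, hφA, hφ0⟩ := exists_powerSeries_lift
    ((PowerSeries.map (algebraMap A P)).comp hD.toIsHS.toRingHom) (fun a => by
      rw [RingHom.comp_apply, ← PowerSeries.coeff_zero_eq_constantCoeff_apply,
        PowerSeries.coeff_map, IsHS.coeff_toRingHom, hD.zero])
  have hφ : ∀ n a, PowerSeries.coeff n (φ (algebraMap A P a)) = algebraMap A P (D n a) :=
    fun n a => by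
      rw [← RingHom.comp_apply, hφA, RingHom.comp_apply, PowerSeries.coeff_map,
        IsHS.coeff_toRingHom]
  let D' : ℕ → P → P := fun n x => PowerSeries.coeff n (φ x)
  have hHS : IsHS D' := IsHS.of_ringHom φ fun x => by
    rw [PowerSeries.coeff_zero_eq_constantCoeff_apply, hφ0]
  have hcomm : ∀ i j x, D' i (D' j x) = D' j (D' i x) := by
    have key : (PowerSeries.map φ).comp φ =
        ((PowerSeries.swap P).comp (PowerSeries.map φ)).comp φ := by
      refine ringHom_ext_of_isSeparable hAF
        (PowerSeries.constantCoeff.comp PowerSeries.constantCoeff) _ _ ?_ ?_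
      · ext x
        simp only [RingHom.comp_apply, ← PowerSeries.coeff_zero_eq_constantCoeff_apply,
          PowerSeries.coeff_coeff_swap]
      · ext a i j
        simp only [RingHom.comp_apply, PowerSeries.coeff_coeff_swap, PowerSeries.coeff_map, hφ,
          hD.comm i j]
    intro i j x
    have := congrArg (fun f => PowerSeries.coeff i (PowerSeries.coeff j f))
      (DFunLike.congr_fun key x)
    simpa only [RingHom.comp_apply, PowerSeries.coeff_coeff_swap, PowerSeries.coeff_map] using this
  have hnil : ∀ n, 1 ≤ n → ∀ x, (D' n)^[p ^ e] x = 0 := by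
    have hE : IsHS fun n => (D' n)^[p ^ e] := hHS.iterate_prime_pow hp hcomm e
    have key : hE.toRingHom = PowerSeries.C := by
      refine ringHom_ext_of_isSeparable hAF PowerSeries.constantCoeff _ _ ?_ ?_
      · ext x
        rw [RingHom.comp_apply, RingHom.comp_apply, PowerSeries.constantCoeff_C,
          ← PowerSeries.coeff_zero_eq_constantCoeff_apply, IsHS.coeff_toRingHom]
        exact hE.zero x
      · ext a n
        rw [RingHom.comp_apply, RingHom.comp_apply, IsHS.coeff_toRingHom, PowerSeries.coeff_C]
        have h1 : (D' n)^[p ^ e] (algebraMap A P a) = algebraMap A P ((D n)^[p ^ e] a) :=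
          (Function.Semiconj.iterate_right (f := algebraMap A P) (fun x => (hφ n x).symm)
            (p ^ e) a).symm
        rw [h1]
        split_ifs with h
        · subst h
          rw [(hD.toIsHS.iterate_prime_pow hp hD.comm e).zero]
        · rw [hD.nil n (Nat.one_le_iff_ne_zero.2 h), map_zero]
    intro n hn x
    have := congrArg (PowerSeries.coeff n) (DFunLike.congr_fun key x)
    rwa [IsHS.coeff_toRingHom, PowerSeries.coeff_C, if_neg (Nat.one_le_iff_ne_zero.1 hn)] at this
  refine ⟨D', ⟨hHS, hcomm, hnil, ?_⟩, hφ⟩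
  let Δ := hHS.taylor hp hcomm e
  have hΔA : ∀ v a, hsComp p e D' v (algebraMap A P a) = algebraMap A P (hsComp p e D v a) :=
    hsComp_of_semiconj (algebraMap A P) hφ p e
  have key : (MvPowerSeries.map Δ).comp Δ = (ptrans p he P).comp Δ := by
    refine ringHom_ext_of_isSeparable hAF
      (MvPowerSeries.constantCoeff.comp MvPowerSeries.constantCoeff) _ _ ?_ ?_
    · ext x
      simp only [RingHom.comp_apply, ← MvPowerSeries.coeff_zero_eq_constantCoeff_apply,
        MvPowerSeries.coeff_map, coeff_ptrans, pop_zero he]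
      simp only [Δ, IsHS.coeff_taylor]
      exact congrArg _ (IsHS.hsComp_zero_of hHS.zero x)
    · ext a j i
      simp only [RingHom.comp_apply, MvPowerSeries.coeff_map, coeff_ptrans, coeff_pop, Δ,
        IsHS.coeff_taylor, hΔA]
      rw [hD.witt, map_sum]
      simp only [map_mul, RingHom.map_zmodCast]
  intro i j x
  have := congrArg (fun f => MvPowerSeries.coeff i (MvPowerSeries.coeff j f))
    (DFunLike.congr_fun key x)
  simpa only [RingHom.comp_apply, MvPowerSeries.coeff_map, coeff_ptrans, coeff_pop, Δ,
        IsHS.coeff_taylor] using this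

end Extension

section Cyclic

variable {k V : Type*} [Field k] [AddCommGroup V] [Module k V] {N : Module.End k V} {q : ℕ} {a : V}

theorem linearIndependent_pow_apply (hN : N ^ (q + 1) = 0) (ha : (N ^ q) a ≠ 0) :
    LinearIndependent k fun l : Fin (q + 1) => (N ^ (l : ℕ)) a := by
  rw [Fintype.linearIndependent_iff]
  intro c hc
  have key : ∀ l : ℕ, ∀ hl : l < q + 1, c ⟨l, hl⟩ = 0 := by
    intro l
    induction l using Nat.strong_induction_on with
    | _ l ih =>
      intro hl
      have h1 := congrArg (N ^ (q - l)) hc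
      rw [map_sum, map_zero, Finset.sum_eq_single ⟨l, hl⟩] at h1
      · rw [map_smul, ← Module.End.mul_apply, ← pow_add, Nat.sub_add_cancel (by omega)] at h1
        exact (smul_eq_zero.1 h1).resolve_right ha
      · intro j _ hj
        rcases lt_or_gt_of_ne (fun h => hj (Fin.ext h) : (j : ℕ) ≠ l) with h | h
        · rw [ih j h j.2, zero_smul, map_zero]
        · rw [map_smul, ← Module.End.mul_apply, ← pow_add,
            show q - l + (j : ℕ) = (j - l - 1) + (q + 1) by omega, pow_add, hN, mul_zero,
            LinearMap.zero_apply, smul_zero]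
      · exact fun h => absurd (Finset.mem_univ _) h
  exact fun i => key i i.2

theorem exists_sum_smul_pow_apply (hN : N ^ (q + 1) = 0)
    (hker : ∀ x, N x = 0 → ∃ c : k, x = c • (N ^ q) a) (x : V) :
    ∃ c : Fin (q + 1) → k, x = ∑ l, c l • (N ^ (l : ℕ)) a := by
  have key : ∀ m, m ≤ q + 1 → ∀ x, (N ^ m) x = 0 →
      x ∈ Submodule.span k ((fun l : ℕ => (N ^ l) a) '' Set.Ico (q + 1 - m) (q + 1)) := by
    intro m
    induction m with
    | zero =>
      intro _ x hx
      rw [pow_zero, Module.End.one_apply] at hx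
      rw [hx]
      exact zero_mem _
    | succ m ih =>
      intro hm x hx
      rw [pow_succ, Module.End.mul_apply] at hx
      have h1 := ih (by omega) _ hx
      have h2 : Submodule.span k ((fun l : ℕ => (N ^ l) a) '' Set.Ico (q + 1 - m) (q + 1)) ≤
          (Submodule.span k ((fun l : ℕ => (N ^ l) a) ''
            Set.Ico (q + 1 - (m + 1)) (q + 1))).map N := by
        rw [Submodule.span_le]
        rintro _ ⟨l, hl, rfl⟩
        rw [Set.mem_Ico] at hl
        refine ⟨(N ^ (l - 1)) a, Submodule.subset_span ⟨l - 1, ?_, rfl⟩, ?_⟩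
        · rw [Set.mem_Ico]; omega
        · rw [← Module.End.mul_apply, ← pow_succ', Nat.sub_add_cancel (by omega)]
      obtain ⟨y, hy, hxy⟩ := h2 h1
      obtain ⟨c, hc⟩ := hker (x - y) (by rw [map_sub, hxy, sub_self])
      rw [← sub_add_cancel x y, hc]
      exact add_mem (Submodule.smul_mem _ _ (Submodule.subset_span ⟨q, by
        rw [Set.mem_Ico]; omega, rfl⟩)) hy
  have h1 := key (q + 1) le_rfl x (by rw [hN, LinearMap.zero_apply])
  have h2 : ((fun l : ℕ => (N ^ l) a) '' Set.Ico (q + 1 - (q + 1)) (q + 1)) =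
      Set.range fun l : Fin (q + 1) => (N ^ (l : ℕ)) a := by
    ext y
    simp only [Set.mem_image, Set.mem_Ico, Set.mem_range]
    exact ⟨fun ⟨l, hl, h⟩ => ⟨⟨l, hl.2⟩, h⟩, fun ⟨l, h⟩ => ⟨l, ⟨by omega, l.2⟩, h⟩⟩
  rw [h2, Submodule.mem_span_range_iff_exists_fun] at h1
  obtain ⟨c, hc⟩ := h1
  exact ⟨c, hc.symm⟩

theorem exists_eq_smul_of_apply_eq_zero (hN : N ^ (q + 1) = 0) (ha : (N ^ q) a ≠ 0)
    [Module.Finite k V] (hr : Module.finrank k V ≤ q + 1) (x : V) (hx : N x = 0) :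
    ∃ c : k, x = c • (N ^ q) a := by
  have hli := linearIndependent_pow_apply hN ha
  have hspan := hli.span_eq_top_of_card_eq_finrank'
    (le_antisymm hli.fintype_card_le_finrank (by simpa using hr))
  have h1 : x ∈ Submodule.span k (Set.range fun l : Fin (q + 1) => (N ^ (l : ℕ)) a) := by
    rw [hspan]; trivial
  rw [Submodule.mem_span_range_iff_exists_fun] at h1
  obtain ⟨c, hc⟩ := h1
  have h2 : ∑ l : Fin (q + 1), (Fin.cons 0 (fun i : Fin q => c i.castSucc) : Fin (q + 1) → k) l • (N ^ (l : ℕ)) a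
      = 0 := by
    rw [Fin.sum_univ_succ]
    simp only [Fin.cons_zero, Fin.cons_succ, zero_smul, zero_add, Fin.val_succ]
    rw [← hx, ← hc, map_sum, Fin.sum_univ_castSucc]
    simp only [map_smul, Fin.val_castSucc, Fin.val_last, ← Module.End.mul_apply, ← pow_succ', hN,
      LinearMap.zero_apply, smul_zero, add_zero]
  have h3 := Fintype.linearIndependent_iff.1 hli _ h2
  refine ⟨c (Fin.last q), ?_⟩
  rw [← hc, Fin.sum_univ_castSucc, Finset.sum_eq_zero, zero_add]
  · rfl
  · intro i _
    have := h3 i.succ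
    rw [Fin.cons_succ] at this
    rw [this, zero_smul]

end Cyclic

section Constants

variable {p : ℕ} [Fact p.Prime] {e : ℕ} {K : Type*} [Field K] [CharP K p] {D : ℕ → K → K}

namespace IsWittHS

theorem apply_one_mul_pow (h : IsWittHS p e D) (x y : K) : D 1 (x * y ^ p) = D 1 x * y ^ p := by
  have hp : p.Prime := Fact.out
  have := h.toIsHS.mul_pow hp 1 1 (by rw [pow_one]; exact hp.one_lt) x y
  rwa [pow_one] at this

/-- The first operator as a linear map over the subfield of `p`-th powers. -/
def toEnd (h : IsWittHS p e D) : Module.End (frobenius K p).fieldRange K where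
  toFun := D 1
  map_add' := h.add 1
  map_smul' := by
    rintro ⟨_, y, rfl⟩ x
    change D 1 (y ^ p * x) = y ^ p * D 1 x
    rw [mul_comm, h.apply_one_mul_pow, mul_comm]

theorem toEnd_pow_apply (h : IsWittHS p e D) (n : ℕ) (x : K) :
    (h.toEnd ^ n) x = (D 1)^[n] x := by
  rw [Module.End.pow_apply]
  rfl

theorem toEnd_pow_eq_zero (h : IsWittHS p e D) : h.toEnd ^ (p ^ e - 1 + 1) = 0 := by
  have hp : p.Prime := Fact.out
  rw [Nat.sub_add_cancel (Nat.one_le_pow _ _ hp.pos)]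
  ext x
  rw [toEnd_pow_apply, h.nil 1 le_rfl, LinearMap.zero_apply]

theorem apply_one_one (h : IsWittHS p e D) : D 1 1 = 0 := h.toIsHS.one_eq_zero 1 le_rfl

/-- The iterates of the first operator at a suitable point are independent over `p`-th powers. -/
theorem eq_zero_of_sum_eq_zero (h : IsWittHS p e D) {a : K} (ha : (D 1)^[p ^ e - 1] a ≠ 0)
    (y : Fin (p ^ e - 1 + 1) → K) (hy : ∑ l : Fin (p ^ e - 1 + 1), (D 1)^[l] a * y l ^ p = 0) (l) : y l = 0 := by
  have hp : p.Prime := Fact.out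
  have h1 := Fintype.linearIndependent_iff.1 (linearIndependent_pow_apply h.toEnd_pow_eq_zero
    (a := a) (by rwa [toEnd_pow_apply])) (fun l => ⟨y l ^ p, y l, rfl⟩) (by
      rw [← hy]
      refine Finset.sum_congr rfl fun l _ => ?_
      rw [toEnd_pow_apply, mul_comm]
      rfl) l
  exact eq_zero_of_pow_eq_zero (Subtype.ext_iff.1 h1)

theorem exists_eq_sum (h : IsWittHS p e D) {a : K} (ha : (D 1)^[p ^ e - 1] a ≠ 0)
    (hroot : ∀ x, D 1 x = 0 → ∃ y, x = y ^ p) (x : K) :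
    ∃ y : Fin (p ^ e - 1 + 1) → K, x = ∑ l : Fin (p ^ e - 1 + 1), (D 1)^[l] a * y l ^ p := by
  have hp : p.Prime := Fact.out
  obtain ⟨c, hc⟩ := exists_sum_smul_pow_apply (a := a) h.toEnd_pow_eq_zero (fun x hx => by
    obtain ⟨y, hy⟩ := hroot x hx
    obtain ⟨z, hz⟩ := hroot ((D 1)^[p ^ e - 1] a) (by
      rw [← Function.iterate_succ_apply' (D 1), Nat.succ_eq_add_one,
        Nat.sub_add_cancel (Nat.one_le_pow _ _ hp.pos), h.nil 1 le_rfl])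
    have hz0 : z ≠ 0 := fun h0 => ha (by rw [hz, h0, zero_pow hp.ne_zero])
    refine ⟨⟨(y / z) ^ p, y / z, rfl⟩, ?_⟩
    rw [toEnd_pow_apply, hy, hz, Subfield.smul_def, smul_eq_mul, ← mul_pow,
      div_mul_cancel₀ _ hz0]) x
  choose y hy using fun l => (c l).2
  refine ⟨y, hc.trans (Finset.sum_congr rfl fun l _ => ?_)⟩
  rw [toEnd_pow_apply, mul_comm]
  exact congrArg (· * _) (hy l).symm

/-- If the field has dimension at most `p ^ e` over its `p`-th powers, then the constants are
`p`-th powers. -/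
theorem exists_eq_pow (h : IsWittHS p e D) {a : K} (ha : (D 1)^[p ^ e - 1] a ≠ 0)
    {ι : Type*} [Fintype ι] (hι : Fintype.card ι ≤ p ^ e) (b : ι → K)
    (hb : ∀ x, ∃ y : ι → K, x = ∑ i, b i * y i ^ p) (x : K) (hx : D 1 x = 0) :
    ∃ y, x = y ^ p := by
  classical
  have hp : p.Prime := Fact.out
  have hspan : Submodule.span (frobenius K p).fieldRange (Set.range b) = ⊤ := by
    rw [eq_top_iff]
    intro x _
    obtain ⟨y, hy⟩ := hb x
    rw [Submodule.mem_span_range_iff_exists_fun]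
    refine ⟨fun i => ⟨y i ^ p, y i, rfl⟩, ?_⟩
    rw [hy]
    refine Finset.sum_congr rfl fun i _ => ?_
    rw [mul_comm]
    rfl
  have hfin : Module.Finite (frobenius K p).fieldRange K :=
    ⟨⟨Finset.univ.image b, by rw [Finset.coe_image, Finset.coe_univ, Set.image_univ, hspan]⟩⟩
  have hr : Module.finrank (frobenius K p).fieldRange K ≤ p ^ e - 1 + 1 := by
    have h1 := finrank_range_le_card (R := (frobenius K p).fieldRange) b
    rw [Set.finrank, hspan, finrank_top] at h1
    omega
  have key := exists_eq_smul_of_apply_eq_zero (a := a) h.toEnd_pow_eq_zero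
    (by rwa [toEnd_pow_apply]) hr
  obtain ⟨c, hc⟩ := key x hx
  obtain ⟨d, hd⟩ := key 1 h.apply_one_one
  rw [Subfield.smul_def, smul_eq_mul] at hc hd
  obtain ⟨y, hy⟩ := c.2
  obtain ⟨z, hz⟩ := d.2
  refine ⟨y / z, ?_⟩
  rw [frobenius_def] at hy hz
  have hz0 : (d : K) ≠ 0 := fun h0 => by simp [h0] at hd
  rw [div_pow, hy, hz, eq_div_iff hz0, hc, mul_assoc, mul_comm _ (d : K), ← hd, mul_one]

end IsWittHS

end Constants

/-- The axioms of the theory for a field with operators. -/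
structure IsHSModel (p : ℕ) [Fact p.Prime] (e : ℕ) {K : Type*} [Field K] (D : ℕ → K → K) :
    Prop extends IsWittHS p e D where
  exists_ne : ∃ x, (D 1)^[p ^ e - 1] x ≠ 0
  root : ∀ x, D 1 x = 0 → ∃ y, x = y ^ p
  sep : IsSepClosed K

section PowerSeriesModel

variable {p : ℕ} [Fact p.Prime] {e : ℕ}

/-- The family of all combinations with `p`-th powers as coefficients. -/
def powSpan (p : ℕ) {ι R : Type*} [Fintype ι] [CommRing R] (b : ι → R) : Set R :=
  {x | ∃ y : ι → R, x = ∑ i, b i * y i ^ p}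

theorem powSpan_mul {ι R : Type*} [Fintype ι] [CommRing R] {b : ι → R} {x : R}
    (hx : x ∈ powSpan p b) (z : R) : x * z ^ p ∈ powSpan p b := by
  obtain ⟨y, rfl⟩ := hx
  refine ⟨fun i => y i * z, ?_⟩
  rw [Finset.sum_mul]
  exact Finset.sum_congr rfl fun i _ => by rw [mul_pow, mul_assoc]

theorem powSpan_add {ι R : Type*} [Fintype ι] [CommRing R] [CharP R p] {b : ι → R} {x x' : R}
    (hx : x ∈ powSpan p b) (hx' : x' ∈ powSpan p b) : x + x' ∈ powSpan p b := by
  obtain ⟨y, rfl⟩ := hx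
  obtain ⟨y', rfl⟩ := hx'
  have : ExpChar R p := ExpChar.prime Fact.out
  refine ⟨fun i => y i + y' i, ?_⟩
  rw [← Finset.sum_add_distrib]
  exact Finset.sum_congr rfl fun i _ => by rw [add_pow_expChar, mul_add]

theorem powSpan_map {ι R S : Type*} [Fintype ι] [CommRing R] [CommRing S] (f : R →+* S)
    {b : ι → R} {x : R} (hx : x ∈ powSpan p b) : f x ∈ powSpan p (f ∘ b) := by
  obtain ⟨y, rfl⟩ := hx
  exact ⟨f ∘ y, by simp⟩

/-- Monomials with exponents below `p`. -/
def lowMonomial (p : ℕ) (e : ℕ) (Ω : Type*) [CommRing Ω] (i : Fin e → Fin p) :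
    MvPowerSeries (Fin e) Ω :=
  MvPowerSeries.monomial (Finsupp.equivFunOnFinite.symm fun m => (i m : ℕ)) 1

theorem mem_powSpan_lowMonomial {Ω : Type*} [Field Ω] [CharP Ω p] [PerfectRing Ω p]
    (f : MvPowerSeries (Fin e) Ω) : f ∈ powSpan p (lowMonomial p e Ω) := by
  classical
  have hp : p.Prime := Fact.out
  have : ExpChar Ω p := ExpChar.prime hp
  let g : (Fin e → Fin p) → MvPowerSeries (Fin e) Ω := fun i m =>
    (frobeniusEquiv Ω p).symm (MvPowerSeries.coeff (p • m +
      Finsupp.equivFunOnFinite.symm fun m => (i m : ℕ)) f)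
  have hg : ∀ i m, MvPowerSeries.coeff m (g i) = (frobeniusEquiv Ω p).symm
    (MvPowerSeries.coeff (p • m + Finsupp.equivFunOnFinite.symm fun m => (i m : ℕ)) f) :=
      fun _ _ => rfl
  refine ⟨g, ?_⟩
  ext n
  let r : Fin e → Fin p := fun m => ⟨n m % p, Nat.mod_lt _ hp.pos⟩
  have hrn : (Finsupp.equivFunOnFinite.symm fun m => (r m : ℕ)) ≤ n := fun m => Nat.mod_le _ _
  rw [map_sum, Finset.sum_eq_single r]
  · rw [lowMonomial, MvPowerSeries.coeff_monomial_mul, if_pos hrn, one_mul,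
      ← MvPowerSeries.map_frobenius_expand p hp.ne_zero, MvPowerSeries.coeff_map]
    have hn : n - Finsupp.equivFunOnFinite.symm (fun m => (r m : ℕ)) =
        p • (n.mapRange (· / p) (Nat.zero_div p)) := by
      ext m
      simp only [Finsupp.coe_tsub, Pi.sub_apply, Finsupp.equivFunOnFinite_symm_apply_apply,
        Finsupp.smul_apply, Finsupp.mapRange_apply, smul_eq_mul, r]
      have := Nat.mod_add_div (n m) p
      omega
    rw [hn, MvPowerSeries.coeff_expand_smul, hg, ← hn, tsub_add_cancel_of_le hrn]
    exact ((frobeniusEquiv Ω p).apply_symm_apply _).symm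
  · intro i _ hi
    rw [lowMonomial, MvPowerSeries.coeff_monomial_mul]
    split_ifs with h
    · rw [one_mul, ← MvPowerSeries.map_frobenius_expand p hp.ne_zero, MvPowerSeries.coeff_map]
      obtain ⟨m, hm⟩ := Function.ne_iff.1 hi
      rw [MvPowerSeries.coeff_expand_of_not_dvd (i := m), map_zero]
      intro hd
      refine hm (Fin.ext ?_)
      have h1 := h m
      simp only [Finsupp.coe_tsub, Pi.sub_apply, Finsupp.equivFunOnFinite_symm_apply_apply] at hd h1
      change _ = n m % p
      have h2 := (Nat.modEq_iff_dvd' h1).2 hd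
      rw [← h2, Nat.mod_eq_of_lt (i m).2]
    · rfl
  · exact fun h => absurd (Finset.mem_univ _) h

theorem mem_powSpan_of_isFractionRing {ι A F : Type*} [Fintype ι] [CommRing A] [Field F]
    [Algebra A F] (hAF : IsFractionRing A F) {b : ι → A} (hb : ∀ x, x ∈ powSpan p b) (x : F) :
    x ∈ powSpan p (algebraMap A F ∘ b) := by
  have hp : p.Prime := Fact.out
  obtain ⟨s, t, rfl⟩ := IsLocalization.exists_mk'_eq (nonZeroDivisors A) x
  have h1 := powSpan_mul (powSpan_map (algebraMap A F) (hb (s * t ^ (p - 1))))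
    ((algebraMap A F t)⁻¹)
  convert h1 using 1
  have ht : algebraMap A F t ≠ 0 := (IsLocalization.map_units F t).ne_zero
  rw [IsLocalization.mk'_eq_iff_eq_mul, map_mul, map_pow, inv_pow]
  have h2 : algebraMap A F t ^ p = algebraMap A F t ^ (p - 1) * algebraMap A F t := by
    rw [← pow_succ, Nat.sub_add_cancel hp.one_le]
  rw [h2]
  field_simp

theorem mem_powSpan_of_isSeparable {ι F P : Type*} [Fintype ι] [Field F] [Field P] [CharP F p]
    [CharP P p] [Algebra F P] [Algebra.IsSeparable F P] {b : ι → F} (hb : ∀ x, x ∈ powSpan p b)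
    (x : P) : x ∈ powSpan p (algebraMap F P ∘ b) := by
  have hp : p.Prime := Fact.out
  have : ExpChar F p := ExpChar.prime hp
  have h1 := Field.span_map_pow_expChar_pow_eq_top_of_isSeparable (F := F) (E := P) (v := id) p 1
    (by rw [Set.range_id, Submodule.span_univ])
  have h2 : x ∈ Submodule.span F (Set.range fun y : P => id y ^ p ^ 1) := by rw [h1]; trivial
  induction h2 using Submodule.span_induction with
  | mem x hx =>
    obtain ⟨y, rfl⟩ := hx
    have := powSpan_mul (powSpan_map (algebraMap F P) (hb 1)) y
    simpa using this
  | zero => exact ⟨0, by simp [hp.ne_zero]⟩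
  | add x y _ _ hx hy => exact powSpan_add hx hy
  | smul c x _ hx =>
    obtain ⟨y, rfl⟩ := hx
    rw [Finset.smul_sum]
    refine Finset.sum_induction _ (· ∈ powSpan p (algebraMap F P ∘ b)) (fun _ _ => powSpan_add)
      ⟨0, by simp [hp.ne_zero]⟩ fun i _ => ?_
    rw [Algebra.smul_def, ← mul_assoc, Function.comp_apply, ← map_mul]
    exact powSpan_mul (powSpan_map _ (hb _)) _

variable (p e) in
/-- Power series over an algebraically closed field embed into a model. -/
theorem exists_isHSModel (he : 1 ≤ e) (Ω : Type) [Field Ω] [IsAlgClosed Ω] [CharP Ω p] :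
    ∃ (P : Type) (_ : Field P) (_ : CharP P p) (D : ℕ → P → P) (c : MvPowerSeries (Fin e) Ω →+* P),
      IsHSModel p e D ∧ ∀ n f, D n (c f) = c (pD p he n f) := by
  have hp : p.Prime := Fact.out
  have : ExpChar Ω p := ExpChar.prime hp
  let F := FractionRing (MvPowerSeries (Fin e) Ω)
  let P := SeparableClosure F
  let hAP : Algebra (MvPowerSeries (Fin e) Ω) P :=
    ((algebraMap F P).comp (algebraMap (MvPowerSeries (Fin e) Ω) F)).toAlgebra
  have hT : IsScalarTower (MvPowerSeries (Fin e) Ω) F P := IsScalarTower.of_algebraMap_eq' rfl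
  have hF : CharP F p := charP_of_injective_algebraMap
    (IsFractionRing.injective (MvPowerSeries (Fin e) Ω) F) p
  have hP : CharP P p := charP_of_injective_algebraMap (algebraMap F P).injective p
  have hAF : IsFractionRing (MvPowerSeries (Fin e) Ω) F := inferInstance
  have hinj : Function.Injective (algebraMap (MvPowerSeries (Fin e) Ω) P) :=
    (algebraMap F P).injective.comp (IsFractionRing.injective (MvPowerSeries (Fin e) Ω) F)
  obtain ⟨D, hD, hDc⟩ := (isWittHS_pD (p := p) (K := Ω) he).exists_extension he (F := F) (P := P) hAF
  have hne : ∃ x, (D 1)^[p ^ e - 1] x ≠ 0 := by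
    obtain ⟨f, hf⟩ := exists_pD_iterate_ne_zero (p := p) (K := Ω) he
    refine ⟨algebraMap _ P f, fun h0 => hf (hinj ?_)⟩
    rw [map_zero, ← h0]
    exact Function.Semiconj.iterate_right (f := algebraMap (MvPowerSeries (Fin e) Ω) P)
      (fun x => (hDc 1 x).symm) _ f
  refine ⟨P, inferInstance, hP, D, algebraMap _ P, ⟨hD, hne, ?_, inferInstance⟩, hDc⟩
  obtain ⟨a, ha⟩ := hne
  refine hD.exists_eq_pow ha (by simp) _ fun x => mem_powSpan_of_isSeparable (F := F)
    (fun y => mem_powSpan_of_isFractionRing hAF (fun z => mem_powSpan_lowMonomial z) y) x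

end PowerSeriesModel

section Embedding

variable {p : ℕ} [Fact p.Prime] {e : ℕ}

/-- The Taylor expansion intertwines the operators with those on power series. -/
theorem IsWittHS.pD_map_taylor (he : 1 ≤ e) {R K : Type*} [CommRing R] [CommRing K] [CharP R p]
    [CharP K p] {D : ℕ → R → R} (h : IsWittHS p e D) (ι : R →+* K) (n : ℕ) (x : R) :
    pD p he n (MvPowerSeries.map ι (h.toIsHS.taylor Fact.out h.comm e x)) =
      MvPowerSeries.map ι (h.toIsHS.taylor Fact.out h.comm e (D n x)) := by
  ext i
  rw [pD, coeff_pop, MvPowerSeries.coeff_map, IsHS.coeff_taylor,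
    ← hsComp_single_zero p e he h.zero n x, h.witt, map_sum]
  refine Finset.sum_congr rfl fun l _ => ?_
  rw [map_mul, RingHom.map_zmodCast, MvPowerSeries.coeff_map, IsHS.coeff_taylor]

/-- Two fields of the same characteristic embed into a common algebraically closed field. -/
theorem exists_isAlgClosed_ringHom (M N : Type) [Field M] [Field N] [CharP M p] [CharP N p] :
    ∃ (Ω : Type) (_ : Field Ω) (_ : IsAlgClosed Ω) (_ : CharP Ω p),
      Nonempty (M →+* Ω) ∧ Nonempty (N →+* Ω) := by
  let : Algebra (ZMod p) M := ZMod.algebra M p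
  let : Algebra (ZMod p) N := ZMod.algebra N p
  let T := TensorProduct (ZMod p) M N
  obtain ⟨m, hm⟩ := Ideal.exists_maximal T
  let : Field (T ⧸ m) := Ideal.Quotient.field m
  let f : M →+* AlgebraicClosure (T ⧸ m) := (algebraMap (T ⧸ m) _).comp
    ((Ideal.Quotient.mk m).comp
      (Algebra.TensorProduct.includeLeft : M →ₐ[ZMod p] T).toRingHom)
  let g : N →+* AlgebraicClosure (T ⧸ m) := (algebraMap (T ⧸ m) _).comp
    ((Ideal.Quotient.mk m).comp
      (Algebra.TensorProduct.includeRight : N →ₐ[ZMod p] T).toRingHom)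
  exact ⟨AlgebraicClosure (T ⧸ m), inferInstance, inferInstance,
    charP_of_injective_ringHom f.injective p, ⟨f⟩, ⟨g⟩⟩

variable (p e) in
theorem exists_isHSModel_amalgam (he : 1 ≤ e) (M N : Type) [Field M] [Field N] [CharP M p]
    [CharP N p] {DM : ℕ → M → M} {DN : ℕ → N → N} (hM : IsWittHS p e DM) (hN : IsWittHS p e DN) :
    ∃ (P : Type) (_ : Field P) (_ : CharP P p) (D : ℕ → P → P) (f : M →+* P) (g : N →+* P),
      IsHSModel p e D ∧ (∀ n x, D n (f x) = f (DM n x)) ∧ ∀ n x, D n (g x) = g (DN n x) := by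
  obtain ⟨Ω, _, _, _, ⟨ι⟩, ⟨κ⟩⟩ := exists_isAlgClosed_ringHom (p := p) M N
  obtain ⟨P, _, hP, D, c, hD, hc⟩ := exists_isHSModel p e he Ω
  refine ⟨P, _, hP, D, c.comp ((MvPowerSeries.map ι).comp (hM.toIsHS.taylor Fact.out hM.comm e)),
    c.comp ((MvPowerSeries.map κ).comp (hN.toIsHS.taylor Fact.out hN.comm e)), hD, ?_, ?_⟩
  · intro n x
    simp only [RingHom.comp_apply, hc, hM.pD_map_taylor he]
  · intro n x
    simp only [RingHom.comp_apply, hc, hN.pD_map_taylor he]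

end Embedding

section Points

/-- Every finite subset of `K` lies in a subalgebra with a rational point. -/
def HasPoints (A K : Type*) [CommRing A] [CommRing K] [Algebra A K] : Prop :=
  ∀ T : Finset K, ∃ (S : Subalgebra A K) (_ : S →ₐ[A] A), (T : Set K) ⊆ S

theorem exists_algHom_range {A B K : Type*} [CommRing A] [CommRing B] [CommRing K] [Algebra A B]
    [Algebra A K] (i : B →ₐ[A] K) (φ : B →ₐ[A] A) (h : ∀ b, i b = 0 → φ b = 0) :
    ∃ _ : i.range →ₐ[A] A, True :=
  ⟨(Ideal.Quotient.liftₐ (RingHom.ker i) φ h).comp (Ideal.quotientKerEquivRange i).symm, trivial⟩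

theorem HasPoints.of_algEquiv {A K L : Type*} [CommRing A] [CommRing K] [CommRing L] [Algebra A K]
    [Algebra A L] (h : HasPoints A K) (i : K ≃ₐ[A] L) : HasPoints A L := by
  classical
  intro T
  obtain ⟨S, φ, hS⟩ := h (T.image i.symm)
  refine ⟨S.comap (i.symm : L →ₐ[A] K), φ.comp (AlgHom.codRestrict
    ((i.symm : L →ₐ[A] K).comp (S.comap (i.symm : L →ₐ[A] K)).val) S fun x => x.2), fun x hx => ?_⟩
  exact hS (Finset.mem_coe.2 (Finset.mem_image_of_mem _ hx))

theorem exists_algHom_subalgebra_of_away {A R L : Type*} (B : Type*) [Field A] [CommRing R]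
    [CommRing B] [Field L] [Algebra A R] [Algebra R B] [Algebra A B] [IsScalarTower A R B]
    [Algebra R L] [Algebra A L] [IsScalarTower A R L] (hinj : Function.Injective (algebraMap R L))
    (d : R) [IsLocalization (Submonoid.powers d) B] (φ : R →ₐ[A] A) (hd : φ d ≠ 0) :
    ∃ (S : Subalgebra A L) (_ : S →ₐ[A] A), ∀ (r : R) (t : L),
      algebraMap R L r = algebraMap R L d * t → t ∈ S := by
  have hd0 : algebraMap R L d ≠ 0 := fun h => hd (by
    rw [hinj (h.trans (map_zero _).symm), map_zero])
  have hf : ∀ y : Submonoid.powers d, IsUnit (IsScalarTower.toAlgHom A R L (y : R)) := by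
    rintro ⟨_, n, rfl⟩
    rw [map_pow]
    exact (Ne.isUnit hd0).pow n
  have hg : ∀ y : Submonoid.powers d, IsUnit (φ (y : R)) := by
    rintro ⟨_, n, rfl⟩
    rw [map_pow]
    exact (Ne.isUnit hd).pow n
  let i : B →ₐ[A] L := IsLocalization.liftAlgHom (M := Submonoid.powers d) hf
  let ψ : B →ₐ[A] A := IsLocalization.liftAlgHom (M := Submonoid.powers d) hg
  have hi : ∀ r, i (algebraMap R B r) = algebraMap R L r := fun r => by
    rw [IsLocalization.liftAlgHom_apply, IsLocalization.lift_eq]; rfl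
  have hψ : ∀ b, i b = 0 → ψ b = 0 := by
    intro b hb
    obtain ⟨r, s, rfl⟩ := IsLocalization.exists_mk'_eq (Submonoid.powers d) b
    have h1 : i (IsLocalization.mk' B r s * algebraMap R B s) = algebraMap R L r := by
      rw [IsLocalization.mk'_spec, hi]
    rw [map_mul, hb, zero_mul] at h1
    have h2 : r = 0 := hinj (h1.symm.trans (map_zero _).symm)
    rw [h2, IsLocalization.mk'_zero, map_zero]
  obtain ⟨χ, -⟩ := exists_algHom_range i ψ hψ
  refine ⟨i.range, χ, fun r t ht => ⟨IsLocalization.mk' B r ⟨d, Submonoid.mem_powers d⟩, ?_⟩⟩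
  have h1 : i (IsLocalization.mk' B r ⟨d, Submonoid.mem_powers d⟩ * algebraMap R B d) =
      algebraMap R L r := by
    rw [← hi]
    exact congrArg i (IsLocalization.mk'_spec B r ⟨d, Submonoid.mem_powers d⟩)
  rw [map_mul, hi, ht, mul_comm] at h1
  exact mul_left_cancel₀ hd0 h1

theorem hasPoints_of_isFractionRing {A R L : Type*} [Field A] [CommRing R] [Field L]
    [Algebra A R] [Algebra R L] [Algebra A L] [IsScalarTower A R L] [IsFractionRing R L]
    (H : ∀ d : R, d ≠ 0 → ∃ φ : R →ₐ[A] A, φ d ≠ 0) : HasPoints A L := by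
  intro T
  have : IsDomain R := (IsFractionRing.injective R L).isDomain (algebraMap R L)
  obtain ⟨⟨d, hd⟩, hT⟩ := IsLocalization.exist_integer_multiples_of_finset (nonZeroDivisors R) T
  obtain ⟨φ, hφ⟩ := H d (nonZeroDivisors.ne_zero hd)
  obtain ⟨S, ψ, h⟩ := exists_algHom_subalgebra_of_away (Localization.Away d)
    (IsFractionRing.injective R L) d φ hφ
  refine ⟨S, ψ, fun t ht => ?_⟩
  obtain ⟨r, hr⟩ := hT t ht
  exact h r t (hr.trans (Algebra.smul_def _ _))

theorem hasPoints_fractionRing {A ι : Type*} [Field A] [Infinite A] :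
    HasPoints A (FractionRing (MvPolynomial ι A)) :=
  hasPoints_of_isFractionRing (R := MvPolynomial ι A) fun d hd => by
    by_contra! h
    exact hd (MvPolynomial.funext fun x => by
      rw [map_zero, ← MvPolynomial.aeval_eq_eval]; exact h (MvPolynomial.aeval x))

theorem HasPoints.of_primitive {A L K : Type*} [Field A] [IsSepClosed A] [Field L] [Field K]
    [Algebra A L] [Algebra L K] [Algebra A K] [IsScalarTower A L K] (h : HasPoints A L) (θ : K)
    (hθ : IsSeparable L θ) (hgen : ∀ x : K, ∃ g : Polynomial L, x = Polynomial.aeval θ g) :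
    HasPoints A K := by
  classical
  intro T
  choose g hg using hgen
  let f := minpoly L θ
  have hfm : f.Monic := minpoly.monic hθ.isIntegral
  obtain ⟨u, v, huv⟩ := hθ
  obtain ⟨S, φ, hS⟩ := h (f.coeffs ∪ u.coeffs ∪ v.coeffs ∪ T.biUnion fun t => (g t).coeffs)
  have hlift : ∀ q : Polynomial L, (q.coeffs : Set L) ⊆ S →
      q ∈ Polynomial.lifts (S.val : S →+* L) := by
    intro q hq
    rw [Polynomial.lifts_iff_coeff_lifts]
    intro n
    by_cases h0 : q.coeff n = 0
    · exact ⟨0, by rw [h0, map_zero]⟩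
    · exact ⟨⟨_, hq (Polynomial.coeff_mem_coeffs h0)⟩, rfl⟩
  simp only [Finset.coe_union, Set.union_subset_iff] at hS
  obtain ⟨⟨⟨hSf, hSu⟩, hSv⟩, hSg⟩ := hS
  obtain ⟨f', hf', hdeg, hfm'⟩ := Polynomial.lifts_and_natDegree_eq_and_monic (hlift f hSf) hfm
  obtain ⟨u', hu'⟩ := (Polynomial.mem_lifts _).1 (hlift u hSu)
  obtain ⟨v', hv'⟩ := (Polynomial.mem_lifts _).1 (hlift v hSv)
  have hinj : Function.Injective (S.val : S →+* L) := Subtype.val_injective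
  have huv' : u' * f' + v' * Polynomial.derivative f' = 1 := by
    apply Polynomial.map_injective _ hinj
    rw [Polynomial.map_add, Polynomial.map_mul, Polynomial.map_mul, ← Polynomial.derivative_map,
      hf', hu', hv', Polynomial.map_one, huv]
  have hsep : (f'.map (φ : S →+* A)).Separable := by
    refine ⟨u'.map (φ : S →+* A), v'.map (φ : S →+* A), ?_⟩
    rw [Polynomial.derivative_map, ← Polynomial.map_mul, ← Polynomial.map_mul, ← Polynomial.map_add,
      huv', Polynomial.map_one]
  obtain ⟨r, hr⟩ := IsSepClosed.exists_root (f'.map (φ : S →+* A)) (by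
    rw [hfm'.degree_map, Polynomial.degree_eq_natDegree hfm'.ne_zero, hdeg]
    have := minpoly.natDegree_pos (hfm.ne_zero |> fun h => (minpoly.ne_zero_iff.1 h))
    exact_mod_cast this.ne') hsep
  let i : Polynomial S →ₐ[A] K :=
    { Polynomial.eval₂RingHom ((algebraMap L K).comp (S.val : S →+* L)) θ with
      commutes' := fun a => by
        change Polynomial.eval₂ _ _ (Polynomial.C (algebraMap A S a)) = _
        rw [Polynomial.eval₂_C]
        exact (IsScalarTower.algebraMap_apply A L K a).symm }
  let ψ : Polynomial S →ₐ[A] A :=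
    { Polynomial.eval₂RingHom (φ : S →+* A) r with
      commutes' := fun a => by
        change Polynomial.eval₂ _ _ (Polynomial.C (algebraMap A S a)) = _
        rw [Polynomial.eval₂_C]
        exact φ.commutes a }
  have hi : ∀ q : Polynomial S, i q = Polynomial.aeval θ (q.map (S.val : S →+* L)) := fun q => by
    rw [Polynomial.aeval_def, Polynomial.eval₂_map]
    rfl
  obtain ⟨χ, -⟩ := exists_algHom_range i ψ (by
    intro q hq
    rw [hi] at hq
    have h1 : f'.map (S.val : S →+* L) ∣ q.map (S.val : S →+* L) := by
      rw [hf']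
      exact minpoly.dvd L θ hq
    rw [Polynomial.map_dvd_map _ hinj hfm'] at h1
    obtain ⟨w, rfl⟩ := h1
    rw [map_mul]
    have h2 : ψ f' = 0 := by
      rw [Polynomial.IsRoot, Polynomial.eval_map] at hr
      exact hr
    rw [h2, zero_mul])
  refine ⟨i.range, χ, fun t ht => ?_⟩
  obtain ⟨g', hg'⟩ := (Polynomial.mem_lifts _).1 (hlift (g t) (by
    refine subset_trans ?_ hSg
    exact_mod_cast Finset.subset_biUnion_of_mem (fun t => (g t).coeffs) ht))
  exact ⟨g', by rw [hg t, ← hg']; exact hi g'⟩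

theorem infinite_of_isSepClosed (A : Type*) [Field A] [IsSepClosed A] : Infinite A := by
  by_contra h
  rw [not_infinite_iff_finite] at h
  have : IsAlgClosed A := inferInstance
  exact not_finite A

theorem hasPoints_of_linearIndepOn_pow (p : ℕ) (hp : p.Prime) {A K : Type*} [Field A]
    [IsSepClosed A] [Field K] [Algebra A K] [Algebra.EssFiniteType A K] [CharP A p]
    (H : ∀ s : Finset K, LinearIndepOn A _root_.id (s : Set K) →
      LinearIndepOn A (· ^ p) (s : Set K)) : HasPoints A K := by
  have : Infinite A := infinite_of_isSepClosed A
  have : ExpChar A p := ExpChar.prime hp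
  obtain ⟨s, hs, hsep⟩ :=
    exists_isTranscendenceBasis_and_isSeparable_of_linearIndepOn_pow_of_essFiniteType p hp H
  have h1 : HasPoints A (IntermediateField.adjoin A (s : Set K)) :=
    (hasPoints_fractionRing.of_algEquiv hs.1.aevalEquivField).of_algEquiv
      (IntermediateField.equivOfEq (by rw [Subtype.range_coe]))
  have : Algebra.EssFiniteType (IntermediateField.adjoin A (s : Set K)) K :=
    Algebra.EssFiniteType.of_comp A _ K
  have : Module.Finite (IntermediateField.adjoin A (s : Set K)) K :=
    Algebra.finite_of_essFiniteType_of_isAlgebraic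
  obtain ⟨θ, hθ⟩ := Field.exists_primitive_element (IntermediateField.adjoin A (s : Set K)) K
  refine h1.of_primitive θ (Algebra.IsSeparable.isSeparable _ θ) fun x => ?_
  have h2 : x ∈ (IntermediateField.adjoin (IntermediateField.adjoin A (s : Set K))
      {θ}).toSubalgebra := by
    rw [hθ]; trivial
  rw [IntermediateField.adjoin_simple_toSubalgebra_of_isAlgebraic
    (Algebra.IsAlgebraic.isAlgebraic θ), Algebra.adjoin_singleton_eq_range_aeval] at h2
  obtain ⟨g, hg⟩ := h2
  exact ⟨g, hg.symm⟩

end Points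

theorem HasPoints.of_adjoin {A M : Type*} [Field A] [Field M] [Algebra A M]
    (h : ∀ T : Finset M, HasPoints A (IntermediateField.adjoin A (T : Set M))) :
    HasPoints A M := by
  classical
  intro T
  let G : Finset (IntermediateField.adjoin A (T : Set M)) := T.attach.image fun t =>
    ⟨t.1, IntermediateField.subset_adjoin A _ t.2⟩
  obtain ⟨S, φ, hS⟩ := h T G
  let i := (IntermediateField.adjoin A (T : Set M)).val
  have hi : Function.Injective i := i.toRingHom.injective
  refine ⟨S.map i, φ.comp (Subalgebra.equivMapOfInjective S i hi).symm.toAlgHom, fun t ht => ?_⟩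
  refine ⟨⟨t, IntermediateField.subset_adjoin A _ ht⟩, hS ?_, rfl⟩
  exact Finset.mem_coe.2 (Finset.mem_image.2 ⟨⟨t, ht⟩, Finset.mem_attach _ _, rfl⟩)

section ExistentiallyClosed

variable {p e : ℕ} [Fact p.Prime] {A M : Type*} [Field A] [Field M] [CharP A p] [CharP M p]
  [Algebra A M] {DA : ℕ → A → A} {DM : ℕ → M → M}

theorem IsHSModel.iterate_algebraMap
    (hj : ∀ n x, DM n (algebraMap A M x) = algebraMap A M (DA n x)) (n m : ℕ) (x : A) :
    (DM n)^[m] (algebraMap A M x) = algebraMap A M ((DA n)^[m] x) := by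
  induction m generalizing x with
  | zero => rfl
  | succ m ih => rw [Function.iterate_succ_apply, Function.iterate_succ_apply, hj, ih]

theorem IsHSModel.linearIndepOn_pow (hA : IsHSModel p e DA) (hM : IsHSModel p e DM)
    (hj : ∀ n x, DM n (algebraMap A M x) = algebraMap A M (DA n x)) {ι : Type*} (t : Finset ι)
    (v : ι → M) (hv : LinearIndepOn A v (t : Set ι)) :
    LinearIndepOn A (fun i => v i ^ p) (t : Set ι) := by
  obtain ⟨a, ha⟩ := hA.exists_ne
  rw [linearIndepOn_finset_iff] at hv ⊢
  intro f hf
  have ha' : (DM 1)^[p ^ e - 1] (algebraMap A M a) ≠ 0 := by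
    rw [IsHSModel.iterate_algebraMap hj]
    exact (map_ne_zero _).2 ha
  choose b hb using hA.toIsWittHS.exists_eq_sum ha hA.root
  have h1 : ∑ l : Fin (p ^ e - 1 + 1), (DM 1)^[l] (algebraMap A M a) *
      (∑ i ∈ t, b (f i) l • v i) ^ p = 0 := by
    rw [← hf]
    have hp : ∀ l : Fin (p ^ e - 1 + 1), (∑ i ∈ t, b (f i) l • v i) ^ p =
        ∑ i ∈ t, algebraMap A M (b (f i) l) ^ p * v i ^ p := fun l => by
      rw [sum_pow_char]
      exact Finset.sum_congr rfl fun i _ => by rw [Algebra.smul_def, mul_pow]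
    simp_rw [hp, Finset.mul_sum]
    rw [Finset.sum_comm]
    refine Finset.sum_congr rfl fun i _ => ?_
    rw [Algebra.smul_def]
    conv_rhs => rw [hb (f i)]
    rw [map_sum, Finset.sum_mul]
    refine Finset.sum_congr rfl fun l _ => ?_
    rw [IsHSModel.iterate_algebraMap hj, map_mul, map_pow, mul_assoc]
  intro i hi
  have h2 := hM.toIsWittHS.eq_zero_of_sum_eq_zero ha' _ h1
  rw [hb (f i)]
  refine Finset.sum_eq_zero fun l _ => ?_
  rw [hv (fun i => b (f i) l) (h2 l) i hi, zero_pow (Fact.out : p.Prime).ne_zero, mul_zero]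

theorem IsHSModel.hasPoints (hA : IsHSModel p e DA) (hM : IsHSModel p e DM)
    (hj : ∀ n x, DM n (algebraMap A M x) = algebraMap A M (DA n x)) : HasPoints A M := by
  have := hA.sep
  refine HasPoints.of_adjoin fun T => ?_
  have : Algebra.EssFiniteType A (IntermediateField.adjoin A (T : Set M)) :=
    IntermediateField.essFiniteType_iff.2 (IntermediateField.fg_adjoin_finset T)
  refine hasPoints_of_linearIndepOn_pow p Fact.out fun s hs => ?_
  let i := (IntermediateField.adjoin A (T : Set M)).val
  have hi : Function.Injective i := i.toRingHom.injective
  have h1 : LinearIndepOn A (fun x => i x) (s : Set _) :=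
    LinearIndependent.map' hs i.toLinearMap (LinearMap.ker_eq_bot.2 hi)
  exact LinearIndependent.of_comp i.toLinearMap (hA.linearIndepOn_pow hM hj s _ h1)

theorem IsHSModel.mem_span_pow (hA : IsHSModel p e DA) (hM : IsHSModel p e DM)
    (hj : ∀ n x, DM n (algebraMap A M x) = algebraMap A M (DA n x)) (m : ℕ) (x : M) :
    x ∈ Submodule.span A (Set.range fun c : M => c ^ p ^ m) := by
  induction m generalizing x with
  | zero => exact Submodule.subset_span ⟨x, by simp⟩
  | succ m ih =>
    obtain ⟨a, ha⟩ := hA.exists_ne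
    have ha' : (DM 1)^[p ^ e - 1] (algebraMap A M a) ≠ 0 := by
      rw [IsHSModel.iterate_algebraMap hj]
      exact (map_ne_zero _).2 ha
    obtain ⟨y, hy⟩ := hM.toIsWittHS.exists_eq_sum ha' hM.root x
    rw [hy]
    refine Submodule.sum_mem _ fun l _ => ?_
    rw [IsHSModel.iterate_algebraMap hj, ← Algebra.smul_def]
    refine Submodule.smul_mem _ _ ?_
    have hyl := ih (y l)
    generalize y l = z at hyl
    induction hyl using Submodule.span_induction with
    | mem z hz =>
      obtain ⟨c, rfl⟩ := hz
      exact Submodule.subset_span ⟨c, by rw [← pow_mul, pow_succ]⟩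
    | zero => rw [zero_pow (Fact.out : p.Prime).ne_zero]; exact Submodule.zero_mem _
    | add z w _ _ hz hw => rw [add_pow_char]; exact Submodule.add_mem _ hz hw
    | smul b z _ hz => rw [smul_pow]; exact Submodule.smul_mem _ _ hz

theorem IsHSModel.exists_partial_hom (hA : IsHSModel p e DA) (hM : IsHSModel p e DM)
    (hj : ∀ n x, DM n (algebraMap A M x) = algebraMap A M (DA n x)) (C : Finset M) (N : ℕ) :
    ∃ g : M → A, (∀ a, g (algebraMap A M a) = a) ∧
      (∀ x ∈ C, ∀ y ∈ C, g (x + y) = g x + g y ∧ g (x * y) = g x * g y) ∧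
      ∀ x ∈ C, ∀ n < N, g (DM n x) = DA n (g x) := by
  classical
  have hp : p.Prime := Fact.out
  choose c hc using fun x => Finsupp.mem_span_range_iff_exists_finsupp.1 (hA.mem_span_pow hM hj N x)
  obtain ⟨S, φ, hS⟩ := hA.hasPoints hM hj (C ∪ C.biUnion fun x => (c x).support)
  have hSC : ∀ x ∈ C, x ∈ S := fun x hx => hS (by simp [hx])
  have hSc : ∀ x ∈ C, ∀ y ∈ (c x).support, y ∈ S := fun x hx y hy =>
    hS (Finset.mem_coe.2 (Finset.mem_union_right _ (Finset.mem_biUnion.2 ⟨x, hx, hy⟩)))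
  let g : M → A := fun x => if h : x ∈ S then φ ⟨x, h⟩ else 0
  have hg : ∀ x : S, g x = φ x := fun x => dif_pos x.2
  have hga : ∀ a, g (algebraMap A M a) = a := fun a => by
    have := hg (algebraMap A S a)
    rw [φ.commutes] at this
    exact this
  refine ⟨g, hga, fun x hx y hy => ?_, fun x hx n hn => ?_⟩
  · have h1 := hg (⟨x, hSC x hx⟩ + ⟨y, hSC y hy⟩)
    have h2 := hg (⟨x, hSC x hx⟩ * ⟨y, hSC y hy⟩)
    rw [map_add, ← hg, ← hg] at h1
    rw [map_mul, ← hg, ← hg] at h2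
    exact ⟨h1, h2⟩
  · have hn' : n < p ^ N := hn.trans (Nat.lt_pow_self hp.one_lt)
    have key : ∀ a : M → A, g (∑ y ∈ (c x).support, algebraMap A M (a y) * y ^ p ^ N) =
        ∑ y ∈ (c x).support, a y * g y ^ p ^ N := fun a => by
      let w : S := ∑ y ∈ (c x).support.attach,
        algebraMap A S (a y) * ⟨y.1, hSc x hx y.1 y.2⟩ ^ p ^ N
      have h1 : (w : M) = ∑ y ∈ (c x).support, algebraMap A M (a y) * y ^ p ^ N := by
        rw [← Finset.sum_attach]
        exact map_sum S.val _ _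
      rw [← h1, hg, map_sum, ← Finset.sum_attach (c x).support]
      refine Finset.sum_congr rfl fun y _ => ?_
      rw [map_mul, map_pow, φ.commutes, ← hg]
      rfl
    have hx' : x = ∑ y ∈ (c x).support, algebraMap A M (c x y) * y ^ p ^ N := by
      conv_lhs => rw [← hc x]
      exact Finset.sum_congr rfl fun y _ => Algebra.smul_def _ _
    have hD : DM n x = ∑ y ∈ (c x).support, algebraMap A M (DA n (c x y)) * y ^ p ^ N := by
      conv_lhs => rw [hx']
      have : ∀ z, DM n z = hM.toIsWittHS.toIsHS.addHom n z := fun z => rfl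
      rw [this, map_sum]
      refine Finset.sum_congr rfl fun y _ => ?_
      rw [← this, hM.toIsWittHS.toIsHS.mul_pow hp N n hn', hj]
    rw [hD, key]
    conv_rhs => rw [hx', key]
    have : ∀ z, DA n z = hA.toIsWittHS.toIsHS.addHom n z := fun z => rfl
    rw [this, map_sum]
    refine Finset.sum_congr rfl fun y _ => ?_
    rw [← this, hA.toIsWittHS.toIsHS.mul_pow hp N n hn']

end ExistentiallyClosed

section ReducedPower

variable {p e : ℕ} [Fact p.Prime] {A S I : Type*} [Field A] [Field S] [CharP A p] [CharP S p]
  {D : ℕ → A → A} {DS : ℕ → S → S} (q : (I → A) →+* S)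

theorem iterate_reducedPower (hD : ∀ n x, DS n (q x) = q fun i => D n (x i)) (n m : ℕ)
    (x : I → A) : (DS n)^[m] (q x) = q fun i => (D n)^[m] (x i) := by
  induction m generalizing x with
  | zero => rfl
  | succ m ih =>
    simp only [Function.iterate_succ_apply]
    rw [hD, ih]

theorem hsComp_reducedPower (hD : ∀ n x, DS n (q x) = q fun i => D n (x i)) (v : Fin e → ℕ)
    (x : I → A) : hsComp p e DS v (q x) = q fun i => hsComp p e D v (x i) := by
  rw [hsComp_of_semiconj q (D := fun n x i => D n (x i)) hD]
  congr 1
  ext i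
  exact (hsComp_of_semiconj (fun x : I → A => x i) (fun _ _ => rfl) p e v x).symm

theorem IsWittHS.reducedPower (h : IsWittHS p e D) (hq : Function.Surjective q)
    (hD : ∀ n x, DS n (q x) = q fun i => D n (x i)) : IsWittHS p e DS where
  zero x := by
    obtain ⟨x, rfl⟩ := hq x
    simp only [hD, h.zero]
  add n x y := by
    obtain ⟨x, rfl⟩ := hq x
    obtain ⟨y, rfl⟩ := hq y
    simp only [← map_add, hD]
    congr 1
    ext i
    exact h.add n _ _
  mul n x y := by
    obtain ⟨x, rfl⟩ := hq x
    obtain ⟨y, rfl⟩ := hq y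
    simp only [← map_mul, hD, ← map_sum]
    congr 1
    ext i
    rw [Finset.sum_apply]
    exact h.mul n _ _
  comm i j x := by
    obtain ⟨x, rfl⟩ := hq x
    simp only [hD, h.comm i j]
  nil n hn x := by
    obtain ⟨x, rfl⟩ := hq x
    rw [iterate_reducedPower q hD]
    simp only [h.nil n hn]
    exact map_zero q
  witt i j x := by
    obtain ⟨x, rfl⟩ := hq x
    have hz : ∀ a : ZMod p, (ZMod.cast a : S) = q fun _ => ZMod.cast a := fun a =>
      (RingHom.map_zmodCast (q.comp (Pi.constRingHom I A)) a).symm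
    simp only [hsComp_reducedPower q hD, hz, ← map_mul, ← map_sum]
    congr 1
    ext k
    rw [Finset.sum_apply]
    exact h.witt i j (x k)

theorem isSepClosed_reducedPower [IsSepClosed A] (hq : Function.Surjective q) {l : Filter I}
    (hl : ∀ x, q x = 0 ↔ ∀ᶠ i in l, x i = 0) : IsSepClosed S := by
  classical
  refine IsSepClosed.of_exists_root S fun f hf hirr hsep => ?_
  have hlift : ∀ g : Polynomial S, g ∈ Polynomial.lifts q := fun g => by
    rw [Polynomial.lifts_iff_coeff_lifts]
    exact fun n => hq _
  obtain ⟨u, v, huv⟩ := hsep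
  obtain ⟨f', hf', hdeg, hfm'⟩ := Polynomial.lifts_and_natDegree_eq_and_monic (hlift f) hf
  obtain ⟨u', hu'⟩ := (Polynomial.mem_lifts _).1 (hlift u)
  obtain ⟨v', hv'⟩ := (Polynomial.mem_lifts _).1 (hlift v)
  let w : Polynomial (I → A) := u' * f' + v' * Polynomial.derivative f' - 1
  have hw : w.map q = 0 := by
    simp only [w, Polynomial.map_sub, Polynomial.map_add, Polynomial.map_mul,
      ← Polynomial.derivative_map, hf', hu', hv', Polynomial.map_one, huv, sub_self]
  have hev : ∀ᶠ i in l, ∀ n ∈ w.support, w.coeff n i = 0 := by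
    rw [Filter.eventually_all_finset]
    intro n _
    rw [← hl, ← Polynomial.coeff_map, hw, Polynomial.coeff_zero]
  let ev : I → (I → A) →+* A := fun i => Pi.evalRingHom (fun _ => A) i
  have hroot : ∀ i, (∀ n ∈ w.support, w.coeff n i = 0) →
      ∃ r : A, Polynomial.eval r (f'.map (ev i)) = 0 := by
    intro i hi
    have hwi : w.map (ev i) = 0 := by
      ext n
      rw [Polynomial.coeff_map, Polynomial.coeff_zero]
      by_cases hn : n ∈ w.support
      · exact hi n hn
      · rw [Polynomial.notMem_support_iff.1 hn, map_zero]
    have hsep : (f'.map (ev i)).Separable := by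
      refine ⟨u'.map (ev i), v'.map (ev i), ?_⟩
      simp only [w, Polynomial.map_sub, Polynomial.map_add, Polynomial.map_mul,
        ← Polynomial.derivative_map, Polynomial.map_one] at hwi
      exact sub_eq_zero.1 hwi
    refine IsSepClosed.exists_root _ ?_ hsep
    have h1 := hirr.natDegree_pos
    rw [← hdeg] at h1
    have : Nontrivial (I → A) := q.domain_nontrivial
    rw [hfm'.degree_map, Polynomial.degree_eq_natDegree hfm'.ne_zero]
    exact_mod_cast h1.ne'
  let r : I → A := fun i => if h : ∀ n ∈ w.support, w.coeff n i = 0 then (hroot i h).choose else 0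
  refine ⟨q r, ?_⟩
  rw [← hf', Polynomial.eval_map, Polynomial.eval₂_at_apply, hl]
  filter_upwards [hev] with i hi
  have h1 := (hroot i hi).choose_spec
  have h2 : r i = (hroot i hi).choose := dif_pos hi
  rw [← h2, Polynomial.eval_map] at h1
  have h3 := Polynomial.eval₂_at_apply (ev i) r (p := f')
  exact h3.symm.trans h1

theorem IsHSModel.reducedPower (h : IsHSModel p e D) (hq : Function.Surjective q)
    (hD : ∀ n x, DS n (q x) = q fun i => D n (x i)) {l : Filter I}
    (hl : ∀ x, q x = 0 ↔ ∀ᶠ i in l, x i = 0) : IsHSModel p e DS where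
  toIsWittHS := h.toIsWittHS.reducedPower q hq hD
  exists_ne := by
    obtain ⟨a, ha⟩ := h.exists_ne
    refine ⟨q fun _ => a, ?_⟩
    rw [iterate_reducedPower q hD]
    exact (map_ne_zero (q.comp (Pi.constRingHom I A))).2 ha
  root x hx := by
    classical
    obtain ⟨x, rfl⟩ := hq x
    rw [hD, hl] at hx
    choose! y hy using h.root
    refine ⟨q fun i => y (x i), ?_⟩
    rw [← sub_eq_zero, ← map_pow, ← map_sub, hl]
    filter_upwards [hx] with i hi
    exact sub_eq_zero.2 (hy _ hi)
  sep := by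
    have := h.sep
    exact isSepClosed_reducedPower q hq hl

end ReducedPower

/-- The ring symbols are interpreted by the ring operations. -/
structure ShfCompatible (M : Type*) [shfLang.Structure M] [Ring M] : Prop where
  add : ∀ a b : M, shfFun (Sum.inl ringFunc.add) ![a, b] = a + b
  mul : ∀ a b : M, shfFun (Sum.inl ringFunc.mul) ![a, b] = a * b
  neg : ∀ a : M, shfFun (Sum.inl ringFunc.neg) ![a] = -a
  zero : shfFun (Sum.inl ringFunc.zero) ![] = (0 : M)
  one : shfFun (Sum.inl ringFunc.one) ![] = (1 : M)

theorem isSHFStructure_iff {p e : ℕ} [Fact p.Prime] {M : Type*} [shfLang.Structure M] :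
    IsSHFStructure p e M ↔ ∃ (_ : Field M) (_ : CharP M p), ShfCompatible M ∧
      IsHSModel p e (shfD : ℕ → M → M) := by
  constructor
  · rintro ⟨_, hp, h1, h2, h3, h4, h5, h6, h7, h8, h9, h10, h11, h12, h13, h14⟩
    exact ⟨_, hp, ⟨h1, h2, h3, h4, h5⟩,
      { zero := h7
        add := h8
        mul := fun n x y => by
          rw [h9, Finset.Nat.sum_antidiagonal_eq_sum_range_succ (fun a b => shfD a x * shfD b y)]
        comm := h10
        nil := h11
        witt := fun i j x => by
          rw [h14, finsum_wittAlpha (p := p) i j (fun l => hsComp p e shfD l x)]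
        exists_ne := h12
        root := h13
        sep := h6 }⟩
  · rintro ⟨_, hp, hc, h⟩
    refine ⟨_, hp, hc.add, hc.mul, hc.neg, hc.zero, hc.one, h.sep, h.zero, h.add, h.mul_range,
      h.comm, h.nil, h.exists_ne, h.root, fun i j x => ?_⟩
    have h1 := h.witt (Finsupp.equivFunOnFinite.symm i) (Finsupp.equivFunOnFinite.symm j) x
    rw [← finsum_wittAlpha (p := p) _ _ (fun l => hsComp p e shfD l x)] at h1
    exact h1

/-- The structure attached to a ring with operators. -/
@[reducible]
def shfStructureOf (K : Type*) [Ring K] (D : ℕ → K → K) : shfLang.Structure K where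
  funMap := fun {n} f => match n, f with
    | _, Sum.inl ringFunc.add => fun v => v 0 + v 1
    | _, Sum.inl ringFunc.mul => fun v => v 0 * v 1
    | _, Sum.inl ringFunc.neg => fun v => -v 0
    | _, Sum.inl ringFunc.zero => fun _ => 0
    | _, Sum.inl ringFunc.one => fun _ => 1
    | 1, Sum.inr n => fun v => D (show ℕ from n) (v 0)
  RelMap := fun _ _ => True

theorem shfCompatible_shfStructureOf (K : Type*) [Ring K] (D : ℕ → K → K) :
    letI := shfStructureOf K D
    ShfCompatible K :=
  letI := shfStructureOf K D
  ⟨fun _ _ => rfl, fun _ _ => rfl, fun _ => rfl, rfl, rfl⟩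

theorem isSHFStructure_shfStructureOf {p e : ℕ} [Fact p.Prime] (K : Type*) [Field K] [CharP K p]
    {D : ℕ → K → K} (h : IsHSModel p e D) :
    letI := shfStructureOf K D
    IsSHFStructure p e K :=
  letI := shfStructureOf K D
  isSHFStructure_iff.2 ⟨_, ‹_›, shfCompatible_shfStructureOf K D, h⟩

instance {n : ℕ} : IsEmpty (shfLang.Relations n) :=
  ⟨fun r => Sum.casesOn r (fun r => Empty.elim r) fun r => Empty.elim r⟩

/-- Induction over the function symbols. -/
theorem shfLang_functions_induction {P : ∀ {n : ℕ}, shfLang.Functions n → Prop}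
    (add : P (n := 2) (Sum.inl ringFunc.add)) (mul : P (n := 2) (Sum.inl ringFunc.mul))
    (neg : P (n := 1) (Sum.inl ringFunc.neg)) (zero : P (n := 0) (Sum.inl ringFunc.zero))
    (one : P (n := 0) (Sum.inl ringFunc.one)) (d : ∀ k, P (dSymb k)) {n : ℕ}
    (f : shfLang.Functions n) : P f := by
  match n, f with
  | _, Sum.inl ringFunc.add => exact add
  | _, Sum.inl ringFunc.mul => exact mul
  | _, Sum.inl ringFunc.neg => exact neg
  | _, Sum.inl ringFunc.zero => exact zero
  | _, Sum.inl ringFunc.one => exact one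
  | 1, Sum.inr k => exact d k

/-- An injective map compatible with all operations is an embedding of structures. -/
def shfEmbedding {M N : Type*} [shfLang.Structure M] [shfLang.Structure N] (f : M → N)
    (hf : Function.Injective f)
    (h : ∀ {n : ℕ} (s : shfLang.Functions n) (v : Fin n → M), f (shfFun s v) = shfFun s (f ∘ v)) :
    M ↪[shfLang] N where
  toFun := f
  inj' := hf
  map_fun' := h
  map_rel' := fun r => isEmptyElim r

section Ring

variable {M N : Type*} [shfLang.Structure M] [shfLang.Structure N] [Ring M] [Ring N]

theorem exists_shfEmbedding (hM : ShfCompatible M) (hN : ShfCompatible N) (f : M →+* N)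
    (hf : Function.Injective f) (hD : ∀ n x, shfD n (f x) = f (shfD n x)) :
    ∃ g : M ↪[shfLang] N, ∀ x, g x = f x := by
  refine ⟨shfEmbedding f hf fun {n} s => ?_, fun _ => rfl⟩
  induction s using shfLang_functions_induction with
  | add =>
    intro v
    rw [show v = ![v 0, v 1] by ext i; fin_cases i <;> rfl, hM.add, map_add, ← hN.add]
    congr 1; ext i; fin_cases i <;> rfl
  | mul =>
    intro v
    rw [show v = ![v 0, v 1] by ext i; fin_cases i <;> rfl, hM.mul, map_mul, ← hN.mul]
    congr 1; ext i; fin_cases i <;> rfl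
  | neg =>
    intro v
    rw [show v = ![v 0] by ext i; fin_cases i; rfl, hM.neg, map_neg, ← hN.neg]
    congr 1; ext i; fin_cases i; rfl
  | zero =>
    intro v
    rw [show v = ![] by ext i; exact i.elim0, hM.zero, map_zero, ← hN.zero]
    congr 1; ext i; exact i.elim0
  | one =>
    intro v
    rw [show v = ![] by ext i; exact i.elim0, hM.one, map_one, ← hN.one]
    congr 1; ext i; exact i.elim0
  | d k =>
    intro v
    rw [show v = ![v 0] by ext i; fin_cases i; rfl]
    refine (hD k (v 0)).symm.trans ?_
    unfold shfD
    congr 1; ext i; fin_cases i; rfl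

theorem shfEmbedding_map_shfFun (j : M ↪[shfLang] N) {n : ℕ} (s : shfLang.Functions n)
    (v : Fin n → M) : j (shfFun s v) = shfFun s (j ∘ v) :=
  j.map_fun s v

/-- The ring homomorphism underlying an embedding of structures. -/
def shfRingHom (hM : ShfCompatible M) (hN : ShfCompatible N) (j : M ↪[shfLang] N) : M →+* N where
  toFun := j
  map_zero' :=
    (congrArg j (hM.zero).symm).trans <| (shfEmbedding_map_shfFun j _ _).trans <|
      (congrArg _ (by ext i; exact i.elim0)).trans (hN.zero)
  map_one' :=
    (congrArg j (hM.one).symm).trans <| (shfEmbedding_map_shfFun j _ _).trans <|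
      (congrArg _ (by ext i; exact i.elim0)).trans (hN.one)
  map_add' x y :=
    (congrArg j (hM.add x y).symm).trans <| (shfEmbedding_map_shfFun j _ _).trans <|
      (congrArg _ (by ext i; fin_cases i <;> rfl)).trans (hN.add (j x) (j y))
  map_mul' x y :=
    (congrArg j (hM.mul x y).symm).trans <| (shfEmbedding_map_shfFun j _ _).trans <|
      (congrArg _ (by ext i; fin_cases i <;> rfl)).trans (hN.mul (j x) (j y))

theorem shfEmbedding_map_shfD (j : M ↪[shfLang] N) (n : ℕ) (x : M) :
    shfD n (j x) = j (shfD n x) := by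
  unfold shfD
  rw [shfEmbedding_map_shfFun]; congr 1; ext i; fin_cases i; rfl

end Ring

section Ultrapower

variable {p e : ℕ} [Fact p.Prime] {A I : Type*} [shfLang.Structure A] (u : Ultrafilter I)

/-- The class of a sequence in the ultrapower. -/
def toUltrapower (x : I → A) : (u : Filter I).Product fun _ => A :=
  Quotient.mk (Filter.productSetoid (u : Filter I) fun _ => A) x

theorem toUltrapower_surjective :
    Function.Surjective (toUltrapower u : (I → A) → (u : Filter I).Product fun _ => A) :=
  Quotient.mk_surjective

theorem toUltrapower_eq_iff (x y : I → A) :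
    toUltrapower u x = toUltrapower u y ↔ ∀ᶠ i in u, x i = y i :=
  Quotient.eq''

theorem shfFun_toUltrapower {n : ℕ} (s : shfLang.Functions n) (x : Fin n → I → A) :
    shfFun s (fun i => toUltrapower u (x i)) = toUltrapower u fun a => shfFun s fun i => x i a :=
  Ultraproduct.funMap_cast s x

/-- The ring structure of an ultrapower of a field. -/
@[reducible]
def ultrapowerField [Field A] : Field ((u : Filter I).Product fun _ => A) :=
  inferInstanceAs (Field (Filter.Germ (u : Filter I) A))

/-- The quotient map as a ring homomorphism. -/
def toUltrapowerHom [Field A] :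
    letI := ultrapowerField (A := A) u
    (I → A) →+* (u : Filter I).Product fun _ => A :=
  Filter.Germ.coeRingHom (u : Filter I)

theorem shfCompatible_ultrapower [Field A] (h : ShfCompatible A) :
    letI := ultrapowerField (A := A) u
    ShfCompatible ((u : Filter I).Product fun _ => A) := by
  let _ := ultrapowerField (A := A) u
  refine ⟨fun a b => ?_, fun a b => ?_, fun a => ?_, ?_, ?_⟩
  · obtain ⟨x, rfl⟩ := toUltrapower_surjective u a
    obtain ⟨y, rfl⟩ := toUltrapower_surjective u b
    refine Eq.trans (congrArg _ ?_) ((shfFun_toUltrapower u _ ![x, y]).trans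
      (congrArg (toUltrapower u) (funext fun i => (congrArg _ ?_).trans (h.add (x i) (y i)))))
    all_goals ext i; fin_cases i <;> rfl
  · obtain ⟨x, rfl⟩ := toUltrapower_surjective u a
    obtain ⟨y, rfl⟩ := toUltrapower_surjective u b
    refine Eq.trans (congrArg _ ?_) ((shfFun_toUltrapower u _ ![x, y]).trans
      (congrArg (toUltrapower u) (funext fun i => (congrArg _ ?_).trans (h.mul (x i) (y i)))))
    all_goals ext i; fin_cases i <;> rfl
  · obtain ⟨x, rfl⟩ := toUltrapower_surjective u a
    refine Eq.trans (congrArg _ ?_) ((shfFun_toUltrapower u _ ![x]).trans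
      (congrArg (toUltrapower u) (funext fun i => (congrArg _ ?_).trans (h.neg (x i)))))
    all_goals ext i; fin_cases i; rfl
  · refine Eq.trans (congrArg _ ?_) ((shfFun_toUltrapower u _ ![]).trans
      (congrArg (toUltrapower u) (funext fun i => (congrArg _ ?_).trans h.zero)))
    all_goals ext i; exact i.elim0
  · refine Eq.trans (congrArg _ ?_) ((shfFun_toUltrapower u _ ![]).trans
      (congrArg (toUltrapower u) (funext fun i => (congrArg _ ?_).trans h.one)))
    all_goals ext i; exact i.elim0

theorem shfD_toUltrapower (n : ℕ) (x : I → A) :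
    shfD n (toUltrapower u x) = toUltrapower u fun i => shfD n (x i) := by
  have h1 : ![toUltrapower u x] = fun l => toUltrapower u (![x] l) := by ext l; fin_cases l; rfl
  have h2 : ∀ i, (fun l => ![x] l i) = ![x i] := fun i => by ext l; fin_cases l; rfl
  unfold shfD
  rw [h1, shfFun_toUltrapower]
  simp only [h2]

theorem realize_toUltrapower [Nonempty A] {α : Type*} {n : ℕ} (φ : shfLang.BoundedFormula α n)
    (x : α → I → A) (v : Fin n → I → A) :
    φ.Realize (fun i => toUltrapower u (x i)) (fun i => toUltrapower u (v i)) ↔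
      ∀ᶠ a in u, φ.Realize (fun i => x i a) fun i => v i a :=
  Ultraproduct.boundedFormula_realize_cast φ x v

theorem isSHFStructure_ultrapower (h : IsSHFStructure p e A) :
    IsSHFStructure p e ((u : Filter I).Product fun _ => A) := by
  obtain ⟨_, hp, hc, h⟩ := isSHFStructure_iff.1 h
  let _ := ultrapowerField (A := A) u
  have hp' : CharP ((u : Filter I).Product fun _ => A) p :=
    charP_of_injective_ringHom
      ((toUltrapowerHom (A := A) u).comp (Pi.constRingHom I A)).injective p
  exact isSHFStructure_iff.2 ⟨_, hp', shfCompatible_ultrapower u hc,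
    h.reducedPower (toUltrapowerHom (A := A) u) (toUltrapower_surjective u)
      (fun n x => shfD_toUltrapower u n x) (l := u) fun x => toUltrapower_eq_iff u x 0⟩

theorem exists_ultrapower_embedding {A M : Type} [shfLang.Structure A] [shfLang.Structure M]
    (hA : IsSHFStructure p e A) (hM : IsSHFStructure p e M) (j : A ↪[shfLang] M) :
    ∃ (I : Type) (u : Ultrafilter I) (k : M ↪[shfLang] (u : Filter I).Product fun _ => A),
      ∀ a, k (j a) = toUltrapower u fun _ => a := by
  classical
  obtain ⟨_, hpA, hcA, hA⟩ := isSHFStructure_iff.1 hA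
  obtain ⟨_, hpM, hcM, hM⟩ := isSHFStructure_iff.1 hM
  let _ : Algebra A M := (shfRingHom hcA hcM j).toAlgebra
  have hj : ∀ n x, shfD n (algebraMap A M x) = algebraMap A M (shfD n x) :=
    shfEmbedding_map_shfD j
  let I := Finset M × ℕ
  choose g hga hgr hgD using fun i : I => hA.exists_partial_hom hM hj i.1 i.2
  have : (Filter.atTop : Filter I).NeBot := inferInstance
  let u : Ultrafilter I := Ultrafilter.of Filter.atTop
  have hu : ∀ (C : Finset M) (N : ℕ), ∀ᶠ i : I in u, C ⊆ i.1 ∧ N ≤ i.2 := fun C N =>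
    Ultrafilter.of_le Filter.atTop (Filter.eventually_ge_atTop ((C, N) : I))
  have hadd : ∀ x y, ∀ᶠ i : I in u, g i (x + y) = g i x + g i y := fun x y => by
    filter_upwards [hu {x, y} 0] with i hi
    exact (hgr i x (hi.1 (by simp)) y (hi.1 (by simp))).1
  have hmul : ∀ x y, ∀ᶠ i : I in u, g i (x * y) = g i x * g i y := fun x y => by
    filter_upwards [hu {x, y} 0] with i hi
    exact (hgr i x (hi.1 (by simp)) y (hi.1 (by simp))).2
  have hg0 : ∀ i, g i 0 = 0 := fun i => by simpa using hga i 0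
  have hg1 : ∀ i, g i 1 = 1 := fun i => by simpa using hga i 1
  let _ := ultrapowerField (A := A) u
  let k : M →+* (u : Filter I).Product fun _ => A :=
    { toFun := fun x => toUltrapower u fun i => g i x
      map_zero' := (toUltrapower_eq_iff u _ _).2 (Filter.Eventually.of_forall hg0)
      map_one' := (toUltrapower_eq_iff u _ _).2 (Filter.Eventually.of_forall hg1)
      map_add' := fun x y => (toUltrapower_eq_iff u _ _).2 (hadd x y)
      map_mul' := fun x y => (toUltrapower_eq_iff u _ _).2 (hmul x y) }
  obtain ⟨k', hk'⟩ := exists_shfEmbedding hcM (shfCompatible_ultrapower u hcA) k k.injective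
    (fun n x => by
      refine (shfD_toUltrapower u n fun i => g i x).trans ((toUltrapower_eq_iff u _ _).2 ?_)
      filter_upwards [hu {x} (n + 1)] with i hi
      exact (hgD i x (hi.1 (by simp)) n hi.2).symm)
  refine ⟨I, u, k', fun a => (hk' _).trans ?_⟩
  exact congrArg (toUltrapower u) (funext fun i => hga i a)

theorem realize_iff_of_embedding {α : Type} {n : ℕ} (φ : shfLang.BoundedFormula α n)
    {A M : Type} [shfLang.Structure A] [shfLang.Structure M]
    (hA : IsSHFStructure p e A) (hM : IsSHFStructure p e M) (j : A ↪[shfLang] M)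
    (v : α → A) (xs : Fin n → A) : φ.Realize (j ∘ v) (j ∘ xs) ↔ φ.Realize v xs := by
  induction φ generalizing A M with
  | falsum => exact (BoundedFormula.IsQF.falsum).realize_embedding j
  | equal t s => exact (BoundedFormula.IsAtomic.equal t s).isQF.realize_embedding j
  | rel r t => exact (BoundedFormula.IsAtomic.rel r t).isQF.realize_embedding j
  | imp φ ψ hφ hψ =>
    rw [BoundedFormula.realize_imp, BoundedFormula.realize_imp, hφ hA hM, hψ hA hM]
  | all φ ih =>
    rw [BoundedFormula.realize_all, BoundedFormula.realize_all]
    constructor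
    · intro h a
      rw [← ih hA hM j, Fin.comp_snoc]
      exact h (j a)
    · intro h m
      obtain ⟨I, u, k, hk⟩ := exists_ultrapower_embedding hA hM j
      rw [← ih hM (isSHFStructure_ultrapower u hA) k, Fin.comp_snoc]
      obtain ⟨y, hy⟩ := toUltrapower_surjective u (k m)
      have : Nonempty A := ⟨shfFun (Sum.inl ringFunc.zero) ![]⟩
      have h1 := (realize_toUltrapower u φ
        (fun i _ => v i) (Fin.snoc (fun i _ => xs i) y)).2 (Filter.Eventually.of_forall fun i => by
          convert h (y i) using 1
          ext l
          refine Fin.lastCases ?_ (fun l => ?_) l <;> simp)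
      convert h1 using 1
      · ext i
        exact hk (v i)
      · ext l
        refine Fin.lastCases ?_ (fun l => ?_) l
        · simpa using hy.symm
        · simpa using hk (xs l)

end Ultrapower

theorem IsSHFStructure.realize_sentence_iff {p e : ℕ} [Fact p.Prime] (he : 1 ≤ e) {M N : Type}
    [shfLang.Structure M] [shfLang.Structure N] (hM : IsSHFStructure p e M)
    (hN : IsSHFStructure p e N) (σ : shfLang.Sentence) : M ⊨ σ ↔ N ⊨ σ := by
  obtain ⟨_, hpM, hcM, hM'⟩ := isSHFStructure_iff.1 hM
  obtain ⟨_, hpN, hcN, hN'⟩ := isSHFStructure_iff.1 hN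
  obtain ⟨P, _, hpP, D, f, g, hD, hf, hg⟩ :=
    exists_isHSModel_amalgam p e he M N hM'.toIsWittHS hN'.toIsWittHS
  let _ := shfStructureOf P D
  have hP : IsSHFStructure p e P := isSHFStructure_shfStructureOf P hD
  obtain ⟨j, -⟩ := exists_shfEmbedding hcM (shfCompatible_shfStructureOf P D) f f.injective hf
  obtain ⟨k, -⟩ := exists_shfEmbedding hcN (shfCompatible_shfStructureOf P D) g g.injective hg
  have h1 := realize_iff_of_embedding σ hM hP j default default
  have h2 := realize_iff_of_embedding σ hN hP k default default
  rw [Subsingleton.elim (j ∘ default) default, Subsingleton.elim (j ∘ default) default] at h1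
  rw [Subsingleton.elim (k ∘ default) default, Subsingleton.elim (k ∘ default) default] at h2
  exact h1.symm.trans h2

theorem exists_isSHFStructure (p e : ℕ) [Fact p.Prime] (he : 1 ≤ e) :
    ∃ (M : Type) (_ : shfLang.Structure M), IsSHFStructure p e M := by
  obtain ⟨P, _, _, D, -, hD, -⟩ := exists_isHSModel p e he (AlgebraicClosure (ZMod p))
  exact ⟨P, _, isSHFStructure_shfStructureOf P hD⟩

theorem IsSHFStructure.model {p e : ℕ} [Fact p.Prime] {M : Type} [shfLang.Structure M]
    (hM : IsSHFStructure p e M) : M ⊨ shfTheory p e :=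
  ⟨fun _ hσ => hσ M _ hM⟩

/-- The theory `SHF-bar_{p,e}` is complete: it is satisfiable, and every sentence or its
negation is a semantic consequence. -/
theorem shfTheory_isComplete (p e : ℕ) [Fact p.Prime] (he : 1 ≤ e) :
    (shfTheory p e).IsComplete := by
  obtain ⟨M, _, hM⟩ := exists_isSHFStructure p e he
  have := hM.model
  have : Nonempty M := ⟨shfFun (Sum.inl ringFunc.zero) ![]⟩
  refine ⟨Theory.Model.isSatisfiable M, fun σ => ?_⟩
  by_cases h : M ⊨ σ
  · exact Or.inl (Theory.models_sentence_of_mem fun N _ hN =>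
      (hM.realize_sentence_iff he hN σ).1 h)
  · exact Or.inr (Theory.models_sentence_of_mem fun N _ hN =>
      (hM.realize_sentence_iff he hN σ.not).1 h)
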